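/- For every n ≥ 1, α > 0 and β > 0, with α̃_N = Nα/(N+1), the t = 1 perturbed total average of the multi-overlap q_{1…n} converges to the unperturbed total average of its filled counterpart q_{1…n}²: lim_{N→∞} ( ⟨q_{1…n}⟩_{N,t=1} − ⟨q_{1…n}²⟩_N ) = 0, where ⟨·⟩_{N,t=1} is taken at connectivity α̃_N and ⟨·⟩_N at connectivity α. -/

import Mathlib

open scoped BigOperators

noncomputable section

/-- The Poisson probability mass function with mean `lam`. -/
def pois (lam : ℝ) (k : ℕ) : ℝ := Real.exp (-lam) * lam ^ k / (Nat.factorial k)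

/-- The spin value (±1) attached to a Boolean opinion. -/
def spin (b : Bool) : ℝ := if b then 1 else -1

/-- Average of `f` over `p` families of `k` i.i.d. indices, each uniform on `Fin N`. -/
def avgIdx (N : ℕ) (p k : ℕ) (f : (Fin p → Fin k → Fin N) → ℝ) : ℝ :=
  ((N : ℝ) ^ (p * k))⁻¹ * ∑ im : Fin p → Fin k → Fin N, f im

/-- The interaction sum `∑_{ν=1}^k σ_{i_ν^1} ⋯ σ_{i_ν^p}`; the Hamiltonian is its negative. -/
def intSum {N p k : ℕ} (im : Fin p → Fin k → Fin N) (σ : Fin N → Bool) : ℝ :=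
  ∑ ν : Fin k, ∏ l : Fin p, spin (σ (im l ν))

/-- The diluted `p`-spin Hamiltonian `H = -∑_{ν=1}^k σ_{i_ν^1} ⋯ σ_{i_ν^p}`. -/
def Hspin {N p k : ℕ} (im : Fin p → Fin k → Fin N) (σ : Fin N → Bool) : ℝ :=
  - intSum im σ

/-- Partition function `Z = ∑_σ e^{-β H(σ)}`. -/
def Zpart (β : ℝ) {N p k : ℕ} (im : Fin p → Fin k → Fin N) : ℝ :=
  ∑ σ : Fin N → Bool, Real.exp (β * intSum im σ)

/-- Cavity term `∑_{ν=1}^{k'} σ_{i_ν^1} ⋯ σ_{i_ν^q}` (with `q = p - 1` families). -/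
def cavSum {N q k' : ℕ} (im' : Fin q → Fin k' → Fin N) (σ : Fin N → Bool) : ℝ :=
  ∑ ν : Fin k', ∏ l : Fin q, spin (σ (im' l ν))

/-- Perturbed Boltzmann weight `exp(β(∑_ν σ_{i_ν^1}⋯σ_{i_ν^p} + ∑_ν σ_{i'_ν^1}⋯σ_{i'_ν^{q}}))`. -/
def wpert (β : ℝ) {N p k q k' : ℕ} (im : Fin p → Fin k → Fin N)
    (im' : Fin q → Fin k' → Fin N) (σ : Fin N → Bool) : ℝ :=
  Real.exp (β * (intSum im σ + cavSum im' σ))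

/-- Perturbed partition function. -/
def Zpert (β : ℝ) {N p k q k' : ℕ} (im : Fin p → Fin k → Fin N)
    (im' : Fin q → Fin k' → Fin N) : ℝ :=
  ∑ σ : Fin N → Bool, wpert β im im' σ

/-- Replicated (unperturbed) Boltzmann state `Ω(g)` on `s` replicas sharing the same disorder. -/
def OmegaB (β : ℝ) {N p k : ℕ} (im : Fin p → Fin k → Fin N)
    (s : ℕ) (g : (Fin s → Fin N → Bool) → ℝ) : ℝ :=
  (∑ σs : Fin s → Fin N → Bool, g σs * ∏ a : Fin s, Real.exp (β * intSum im (σs a))) /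
    (Zpart β im) ^ s

/-- Replicated perturbed Boltzmann state `Ω̃_t(g)` on `s` replicas sharing the same disorder. -/
def OmegaPert (β : ℝ) {N p k q k' : ℕ} (im : Fin p → Fin k → Fin N)
    (im' : Fin q → Fin k' → Fin N) (s : ℕ) (g : (Fin s → Fin N → Bool) → ℝ) : ℝ :=
  (∑ σs : Fin s → Fin N → Bool, g σs * ∏ a : Fin s, wpert β im im' (σs a)) /
    (Zpert β im im') ^ s

/-- Quenched expectation: the number of interaction terms is Poisson of mean `γ N` and the
`p` index families are i.i.d. uniform on `Fin N`. -/
def Equench (N p : ℕ) (γ : ℝ) (f : (k : ℕ) → (Fin p → Fin k → Fin N) → ℝ) : ℝ :=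
  ∑' k : ℕ, pois (γ * N) k * avgIdx N p k (fun im => f k im)

/-- Quenched expectation including the cavity randomness: the cavity term has a Poisson
number of terms of mean `2 γ t`, with `p - 1` independent uniform index families. -/
def EquenchCav (N p : ℕ) (γ t : ℝ)
    (f : (k : ℕ) → (Fin p → Fin k → Fin N) →
         (k' : ℕ) → (Fin (p - 1) → Fin k' → Fin N) → ℝ) : ℝ :=
  ∑' k : ℕ, pois (γ * N) k * avgIdx N p k (fun im =>
    ∑' k' : ℕ, pois (2 * γ * t) k' * avgIdx N (p - 1) k' (fun im' => f k im k' im'))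

/-- Quenched average of `ln Z_N`. -/
def ElnZ (N p : ℕ) (γ β : ℝ) : ℝ :=
  Equench N p γ (fun _ im => Real.log (Zpart β im))

/-- Quenched pressure `A_N = (1/N) E[ln Z_N]`. -/
def pressure (N p : ℕ) (γ β : ℝ) : ℝ :=
  (N : ℝ)⁻¹ * ElnZ N p γ β

/-- Cavity function `Ψ_N(t) = E[ln (Z_{N,t} / Z_N)]`. -/
def cavityFn (N p : ℕ) (γ β t : ℝ) : ℝ :=
  EquenchCav N p γ t (fun _ im _ im' => Real.log (Zpert β im im' / Zpart β im))

/-- The multi-overlap `q_{1…n} = (1/N) ∑_i σ_i^{(1)} ⋯ σ_i^{(n)}` of `n` replicas. -/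
def qOv (N n : ℕ) (σs : Fin n → Fin N → Bool) : ℝ :=
  (N : ℝ)⁻¹ * ∑ x : Fin N, ∏ a : Fin n, spin (σs a x)

/-- Total (quenched) average `⟨q_{1…n}^r⟩_N` of the `r`-th power of the `n`-replica overlap. -/
def qPowAvg (N p : ℕ) (γ β : ℝ) (n r : ℕ) : ℝ :=
  Equench N p γ (fun _ im => OmegaB β im n (fun σs => (qOv N n σs) ^ r))

/-- Perturbed total average `⟨q_{1…n}^r⟩_{N,t}` of the `r`-th power of the `n`-replica overlap. -/
def qPowAvgPert (N p : ℕ) (γ β t : ℝ) (n r : ℕ) : ℝ :=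
  EquenchCav N p γ t (fun _ im _ im' => OmegaPert β im im' n (fun σs => (qOv N n σs) ^ r))

end

open Filter

section Gibbs

variable {ι : Type*}

/-- The product of the two spins at the ends of a bond. -/
def bondSpin (σ : ι → Bool) (e : Sym2 ι) : ℝ :=
  Sym2.lift ⟨fun i j => spin (σ i) * spin (σ j), fun _ _ => mul_comm _ _⟩ e

/-- The sum of the bond spins over a multiset of bonds. -/
def bondSum (s : Multiset (Sym2 ι)) (σ : ι → Bool) : ℝ := (s.map (bondSpin σ)).sum

/-- The Boltzmann weight of a multiset of bonds. -/
noncomputable def bondWeight (β : ℝ) (s : Multiset (Sym2 ι)) (σ : ι → Bool) : ℝ :=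
  Real.exp (β * bondSum s σ)

/-- The Boltzmann average attached to a multiset of bonds. -/
noncomputable def gibbs [Fintype ι] [DecidableEq ι] (β : ℝ) (s : Multiset (Sym2 ι))
    (g : (ι → Bool) → ℝ) : ℝ :=
  (∑ σ, g σ * bondWeight β s σ) / ∑ σ, bondWeight β s σ

/-- The product of the spins at the sites of a multiset. -/
def siteSpin (t : Multiset ι) (σ : ι → Bool) : ℝ := (t.map fun i => spin (σ i)).prod

theorem spin_mul_self (b : Bool) : spin b * spin b = 1 := by cases b <;> simp [spin]

theorem spin_beq (a b : Bool) : spin (a == b) = spin a * spin b := by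
  cases a <;> cases b <;> simp [spin]

theorem abs_spin (b : Bool) : |spin b| = 1 := by cases b <;> simp [spin]

theorem bondSpin_mk (σ : ι → Bool) (i j : ι) :
    bondSpin σ s(i, j) = spin (σ i) * spin (σ j) := rfl

theorem abs_bondSpin (σ : ι → Bool) (e : Sym2 ι) : |bondSpin σ e| = 1 := by
  induction e using Sym2.ind with
  | _ i j => rw [bondSpin_mk, abs_mul, abs_spin, abs_spin, one_mul]

theorem bondSpin_eq_or (σ : ι → Bool) (e : Sym2 ι) : bondSpin σ e = 1 ∨ bondSpin σ e = -1 :=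
  eq_or_eq_neg_of_abs_eq (abs_bondSpin σ e)

theorem bondSpin_beq (σ ρ : ι → Bool) (e : Sym2 ι) :
    bondSpin (fun i => σ i == ρ i) e = bondSpin σ e * bondSpin ρ e := by
  induction e using Sym2.ind with
  | _ i j => simp only [bondSpin_mk, spin_beq]; ring

theorem siteSpin_beq (σ ρ : ι → Bool) (t : Multiset ι) :
    siteSpin t (fun i => σ i == ρ i) = siteSpin t σ * siteSpin t ρ := by
  simp only [siteSpin, spin_beq, Multiset.prod_map_mul]

theorem siteSpin_add (t u : Multiset ι) (σ : ι → Bool) :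
    siteSpin (t + u) σ = siteSpin t σ * siteSpin u σ := by
  simp [siteSpin]

theorem siteSpin_pair (i j : ι) (σ : ι → Bool) :
    siteSpin {i, j} σ = spin (σ i) * spin (σ j) := by
  simp [siteSpin]

theorem abs_siteSpin (t : Multiset ι) (σ : ι → Bool) : |siteSpin t σ| = 1 := by
  induction t using Multiset.induction_on with
  | empty => simp [siteSpin]
  | cons a t ih =>
    rw [← Multiset.singleton_add, siteSpin_add, abs_mul, ih]
    simp [siteSpin, abs_spin]

theorem exp_mul_bondSpin (J : ℝ) (σ : ι → Bool) (e : Sym2 ι) :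
    Real.exp (J * bondSpin σ e) = Real.cosh J + bondSpin σ e * Real.sinh J := by
  rcases bondSpin_eq_or σ e with h | h <;> rw [h] <;> simp [Real.cosh_eq, Real.sinh_eq] <;> ring

theorem bondWeight_pos (β : ℝ) (s : Multiset (Sym2 ι)) (σ : ι → Bool) : 0 < bondWeight β s σ :=
  Real.exp_pos _

variable [Fintype ι] [DecidableEq ι]

theorem sum_siteSpin_nonneg (t : Multiset ι) : 0 ≤ ∑ σ : ι → Bool, siteSpin t σ := by
  have h : ∀ σ : ι → Bool, siteSpin t σ = ∏ i, spin (σ i) ^ t.count i := by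
    intro σ
    rw [siteSpin, Finset.prod_multiset_map_count]
    refine Finset.prod_subset (Finset.subset_univ _) fun i _ hi => ?_
    rw [Multiset.count_eq_zero_of_notMem (by simpa using hi), pow_zero]
  simp only [h]
  rw [← Fintype.prod_sum (fun i (b : Bool) => spin b ^ t.count i)]
  refine Finset.prod_nonneg fun i _ => ?_
  rcases neg_one_pow_eq_or ℝ (t.count i) with h | h <;> simp [spin, h]

/-- Griffiths' first inequality. -/
theorem sum_siteSpin_mul_exp_nonneg (J : Sym2 ι → ℝ) (hJ : ∀ e, 0 ≤ J e)
    (s : Multiset (Sym2 ι)) (t : Multiset ι) :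
    0 ≤ ∑ σ, siteSpin t σ * Real.exp (s.map fun e => J e * bondSpin σ e).sum := by
  induction s using Multiset.induction_on generalizing t with
  | empty => simpa using sum_siteSpin_nonneg t
  | cons e s ih =>
    induction e using Sym2.ind with
    | _ i j =>
      have h : ∀ σ, siteSpin t σ *
          Real.exp (Multiset.map (fun e => J e * bondSpin σ e) (s(i, j) ::ₘ s)).sum =
          Real.cosh (J s(i, j)) *
            (siteSpin t σ * Real.exp (s.map fun e => J e * bondSpin σ e).sum) +
          Real.sinh (J s(i, j)) *
            (siteSpin (t + {i, j}) σ * Real.exp (s.map fun e => J e * bondSpin σ e).sum) := by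
        intro σ
        rw [Multiset.map_cons, Multiset.sum_cons, Real.exp_add, exp_mul_bondSpin, siteSpin_add,
          siteSpin_pair, bondSpin_mk]
        ring
      simp only [h, Finset.sum_add_distrib, ← Finset.mul_sum]
      exact add_nonneg (mul_nonneg (Real.cosh_pos _).le (ih _))
        (mul_nonneg (Real.sinh_nonneg_iff.2 (hJ _)) (ih _))

theorem sum_bondWeight_pos (β : ℝ) (s : Multiset (Sym2 ι)) :
    0 < ∑ σ : ι → Bool, bondWeight β s σ :=
  Finset.sum_pos (fun σ _ => bondWeight_pos β s σ) Finset.univ_nonempty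

/-- Griffiths' second inequality. -/
theorem gibbs_siteSpin_mul_le {β : ℝ} (hβ : 0 ≤ β) (s : Multiset (Sym2 ι)) (t u : Multiset ι) :
    gibbs β s (siteSpin t) * gibbs β s (siteSpin u) ≤
      gibbs β s (fun σ => siteSpin t σ * siteSpin u σ) := by
  have hZ := sum_bondWeight_pos (ι := ι) β s
  have hflip : ∀ (σ : ι → Bool) (f : (ι → Bool) → ℝ), ∑ τ, f τ =
      ∑ ρ : ι → Bool, f (fun i => σ i == ρ i) := by
    intro σ f
    have hinv : Function.Involutive fun (ρ : ι → Bool) i => σ i == ρ i := by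
      intro ρ
      funext i
      change (σ i == (σ i == ρ i)) = ρ i
      cases σ i <;> cases ρ i <;> rfl
    exact (Equiv.sum_comp hinv.toPerm f).symm
  have hkey : 0 ≤ ∑ σ, ∑ τ, (siteSpin t σ * siteSpin u σ - siteSpin t σ * siteSpin u τ) *
      (bondWeight β s σ * bondWeight β s τ) := by
    have h1 : ∀ σ : ι → Bool,
        ∑ τ, (siteSpin t σ * siteSpin u σ - siteSpin t σ * siteSpin u τ) *
          (bondWeight β s σ * bondWeight β s τ) =
        ∑ ρ, (1 - siteSpin u ρ) * (siteSpin (t + u) σ *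
          Real.exp (s.map fun e => β * (1 + bondSpin ρ e) * bondSpin σ e).sum) := by
      intro σ
      rw [hflip σ]
      refine Finset.sum_congr rfl fun ρ _ => ?_
      have : bondWeight β s σ * bondWeight β s (fun i => σ i == ρ i) =
          Real.exp (s.map fun e => β * (1 + bondSpin ρ e) * bondSpin σ e).sum := by
        simp only [bondWeight, bondSum, bondSpin_beq]
        rw [← Real.exp_add, ← mul_add, ← Multiset.sum_map_add, ← Multiset.sum_map_mul_left]
        congr 2
        refine Multiset.map_congr rfl fun e _ => ?_
        ring
      rw [this, siteSpin_beq, siteSpin_add]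
      ring
    simp only [h1]
    rw [Finset.sum_comm]
    refine Finset.sum_nonneg fun ρ _ => ?_
    rw [← Finset.mul_sum]
    refine mul_nonneg ?_ (sum_siteSpin_mul_exp_nonneg _ (fun e => ?_) _ _)
    · linarith [le_abs_self (siteSpin u ρ), abs_siteSpin u ρ]
    · have := neg_abs_le (bondSpin ρ e)
      rw [abs_bondSpin] at this
      exact mul_nonneg hβ (by linarith)
  have hexp : ∑ σ, ∑ τ, (siteSpin t σ * siteSpin u σ - siteSpin t σ * siteSpin u τ) *
      (bondWeight β s σ * bondWeight β s τ) =
      (∑ σ, siteSpin t σ * siteSpin u σ * bondWeight β s σ) * (∑ σ, bondWeight β s σ) -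
      (∑ σ, siteSpin t σ * bondWeight β s σ) * (∑ σ, siteSpin u σ * bondWeight β s σ) := by
    rw [Finset.sum_mul_sum, Finset.sum_mul_sum, ← Finset.sum_sub_distrib]
    refine Finset.sum_congr rfl fun σ _ => ?_
    rw [← Finset.sum_sub_distrib]
    exact Finset.sum_congr rfl fun τ _ => by ring
  rw [hexp] at hkey
  rw [gibbs, gibbs, gibbs, div_mul_div_comm, div_le_div_iff₀ (mul_pos hZ hZ) hZ]
  nlinarith

theorem gibbs_sum {κ : Type*} (β : ℝ) (s : Multiset (Sym2 ι)) (K : Finset κ)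
    (g : κ → (ι → Bool) → ℝ) : gibbs β s (fun σ => ∑ k ∈ K, g k σ) = ∑ k ∈ K, gibbs β s (g k) := by
  simp only [gibbs, Finset.sum_mul]
  rw [Finset.sum_comm, Finset.sum_div]

theorem gibbs_const_mul (β : ℝ) (s : Multiset (Sym2 ι)) (c : ℝ) (g : (ι → Bool) → ℝ) :
    gibbs β s (fun σ => c * g σ) = c * gibbs β s g := by
  simp only [gibbs, mul_assoc, ← Finset.mul_sum, mul_div_assoc]

theorem gibbs_add (β : ℝ) (s : Multiset (Sym2 ι)) (g h : (ι → Bool) → ℝ) :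
    gibbs β s (fun σ => g σ + h σ) = gibbs β s g + gibbs β s h := by
  simp only [gibbs, add_mul, Finset.sum_add_distrib, add_div]

theorem gibbs_const (β : ℝ) (s : Multiset (Sym2 ι)) (c : ℝ) : gibbs β s (fun _ => c) = c := by
  rw [gibbs, ← Finset.mul_sum, mul_div_assoc, div_self (sum_bondWeight_pos β s).ne', mul_one]

theorem gibbs_mono (β : ℝ) (s : Multiset (Sym2 ι)) {g h : (ι → Bool) → ℝ} (hgh : ∀ σ, g σ ≤ h σ) :
    gibbs β s g ≤ gibbs β s h :=
  div_le_div_of_nonneg_right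
    (Finset.sum_le_sum fun σ _ => mul_le_mul_of_nonneg_right (hgh σ) (bondWeight_pos β s σ).le)
    (sum_bondWeight_pos β s).le

theorem gibbs_nonneg (β : ℝ) (s : Multiset (Sym2 ι)) {g : (ι → Bool) → ℝ} (hg : ∀ σ, 0 ≤ g σ) :
    0 ≤ gibbs β s g :=
  div_nonneg (Finset.sum_nonneg fun σ _ => mul_nonneg (hg σ) (bondWeight_pos β s σ).le)
    (sum_bondWeight_pos β s).le

theorem abs_gibbs_le (β : ℝ) (s : Multiset (Sym2 ι)) {g : (ι → Bool) → ℝ} {c : ℝ}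
    (hg : ∀ σ, |g σ| ≤ c) : |gibbs β s g| ≤ c := by
  rw [abs_le]
  constructor
  · rw [← gibbs_const β s (-c)]
    exact gibbs_mono β s fun σ => (abs_le.1 (hg σ)).1
  · conv_rhs => rw [← gibbs_const β s c]
    exact gibbs_mono β s fun σ => (abs_le.1 (hg σ)).2

theorem abs_gibbs_siteSpin_le (β : ℝ) (s : Multiset (Sym2 ι)) (t : Multiset ι) :
    |gibbs β s (siteSpin t)| ≤ 1 :=
  abs_gibbs_le β s fun σ => (abs_siteSpin t σ).le

theorem gibbs_siteSpin_nonneg {β : ℝ} (hβ : 0 ≤ β) (s : Multiset (Sym2 ι)) (t : Multiset ι) :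
    0 ≤ gibbs β s (siteSpin t) := by
  refine div_nonneg ?_ (sum_bondWeight_pos β s).le
  have := sum_siteSpin_mul_exp_nonneg (fun _ => β) (fun _ => hβ) s t
  simpa only [bondWeight, bondSum, ← Multiset.sum_map_mul_left] using this

omit [Fintype ι] [DecidableEq ι] in
theorem bondWeight_add (β : ℝ) (s t : Multiset (Sym2 ι)) (σ : ι → Bool) :
    bondWeight β (s + t) σ = bondWeight β s σ * bondWeight β t σ := by
  simp only [bondWeight, bondSum, Multiset.map_add, Multiset.sum_add, mul_add, Real.exp_add]

omit [Fintype ι] [DecidableEq ι] in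
theorem abs_bondSum_le (t : Multiset (Sym2 ι)) (σ : ι → Bool) : |bondSum t σ| ≤ t.card := by
  induction t using Multiset.induction_on with
  | empty => simp [bondSum]
  | cons e t ih =>
    have h : bondSum (e ::ₘ t) σ = bondSpin σ e + bondSum t σ := by simp [bondSum]
    rw [h, Multiset.card_cons, Nat.cast_add, Nat.cast_one, add_comm (t.card : ℝ)]
    exact (abs_add_le _ _).trans (add_le_add (abs_bondSpin σ e).le ih)

theorem gibbs_add_le {β : ℝ} (hβ : 0 ≤ β) (s t : Multiset (Sym2 ι)) {g : (ι → Bool) → ℝ}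
    (hg : ∀ σ, 0 ≤ g σ) :
    gibbs β (s + t) g ≤ Real.exp (2 * β * t.card) * gibbs β s g := by
  have hub : ∀ σ, bondWeight β t σ ≤ Real.exp (β * t.card) := fun σ =>
    Real.exp_le_exp.2 (mul_le_mul_of_nonneg_left (abs_le.1 (abs_bondSum_le t σ)).2 hβ)
  have hlb : ∀ σ, Real.exp (-(β * t.card)) ≤ bondWeight β t σ := fun σ =>
    Real.exp_le_exp.2 (by nlinarith [(abs_le.1 (abs_bondSum_le t σ)).1])
  have hnum : ∑ σ, g σ * bondWeight β (s + t) σ ≤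
      Real.exp (β * t.card) * ∑ σ, g σ * bondWeight β s σ := by
    rw [Finset.mul_sum]
    refine Finset.sum_le_sum fun σ _ => ?_
    rw [bondWeight_add, ← mul_assoc, mul_comm (Real.exp _)]
    exact mul_le_mul_of_nonneg_left (hub σ) (mul_nonneg (hg σ) (bondWeight_pos β s σ).le)
  have hden : Real.exp (-(β * t.card)) * ∑ σ : ι → Bool, bondWeight β s σ ≤
      ∑ σ : ι → Bool, bondWeight β (s + t) σ := by
    rw [Finset.mul_sum]
    refine Finset.sum_le_sum fun σ _ => ?_
    rw [bondWeight_add, mul_comm]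
    exact mul_le_mul_of_nonneg_left (hlb σ) (bondWeight_pos β s σ).le
  have hZ := sum_bondWeight_pos (ι := ι) β s
  have hnn : 0 ≤ ∑ σ, g σ * bondWeight β s σ :=
    Finset.sum_nonneg fun σ _ => mul_nonneg (hg σ) (bondWeight_pos β s σ).le
  calc gibbs β (s + t) g
      ≤ (Real.exp (β * t.card) * ∑ σ, g σ * bondWeight β s σ) /
        (Real.exp (-(β * t.card)) * ∑ σ, bondWeight β s σ) :=
        div_le_div₀ (mul_nonneg (Real.exp_pos _).le hnn) hnum (mul_pos (Real.exp_pos _) hZ) hden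
    _ = Real.exp (2 * β * t.card) * gibbs β s g := by
        rw [gibbs, mul_div_mul_comm, ← Real.exp_sub]
        congr 2
        ring

omit [Fintype ι] [DecidableEq ι] in
theorem bondWeight_cons (β : ℝ) (s : Multiset (Sym2 ι)) (e : Sym2 ι) (σ : ι → Bool) :
    bondWeight β (e ::ₘ s) σ =
      (Real.cosh β + bondSpin σ e * Real.sinh β) * bondWeight β s σ := by
  simp only [bondWeight, bondSum, Multiset.map_cons, Multiset.sum_cons, mul_add, Real.exp_add,
    exp_mul_bondSpin]

theorem gibbs_cons (β : ℝ) (s : Multiset (Sym2 ι)) (e : Sym2 ι) (g : (ι → Bool) → ℝ) :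
    gibbs β (e ::ₘ s) g =
      (Real.cosh β * gibbs β s g + Real.sinh β * gibbs β s (fun σ => g σ * bondSpin σ e)) /
      (Real.cosh β + Real.sinh β * gibbs β s (fun σ => bondSpin σ e)) := by
  have hZ := (sum_bondWeight_pos (ι := ι) β s).ne'
  have h1 : ∑ σ, g σ * bondWeight β (e ::ₘ s) σ = Real.cosh β * ∑ σ, g σ * bondWeight β s σ +
      Real.sinh β * ∑ σ, g σ * bondSpin σ e * bondWeight β s σ := by
    rw [Finset.mul_sum, Finset.mul_sum, ← Finset.sum_add_distrib]
    exact Finset.sum_congr rfl fun σ _ => by rw [bondWeight_cons]; ring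
  have h2 : ∑ σ : ι → Bool, bondWeight β (e ::ₘ s) σ = Real.cosh β * ∑ σ, bondWeight β s σ +
      Real.sinh β * ∑ σ, bondSpin σ e * bondWeight β s σ := by
    rw [Finset.mul_sum, Finset.mul_sum, ← Finset.sum_add_distrib]
    exact Finset.sum_congr rfl fun σ _ => by rw [bondWeight_cons]; ring
  have h3 : ∀ a b c Z : ℝ, Z ≠ 0 →
      (Real.cosh β * a + Real.sinh β * b) / (Real.cosh β * Z + Real.sinh β * c) =
      (Real.cosh β * (a / Z) + Real.sinh β * (b / Z)) / (Real.cosh β + Real.sinh β * (c / Z)) := by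
    intro a b c Z hZ
    rw [← div_div_div_cancel_right₀ hZ]
    congr 1 <;> field_simp
  rw [gibbs, h1, h2, h3 _ _ _ _ hZ]
  rfl

/-- Adding a bond raises a correlation by at least a multiple of its covariance with the bond. -/
theorem gibbs_siteSpin_cons_sub_ge {β : ℝ} (hβ : 0 ≤ β) (s : Multiset (Sym2 ι)) (e : Sym2 ι)
    (t : Multiset ι) :
    Real.sinh β * Real.exp (-β) * (gibbs β s (fun σ => siteSpin t σ * bondSpin σ e) -
      gibbs β s (siteSpin t) * gibbs β s (fun σ => bondSpin σ e)) ≤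
    gibbs β (e ::ₘ s) (siteSpin t) - gibbs β s (siteSpin t) := by
  have hcov : 0 ≤ gibbs β s (fun σ => siteSpin t σ * bondSpin σ e) -
      gibbs β s (siteSpin t) * gibbs β s (fun σ => bondSpin σ e) := by
    induction e using Sym2.ind with
    | _ i j =>
      have := gibbs_siteSpin_mul_le hβ s t {i, j}
      simp only [siteSpin_pair, ← bondSpin_mk] at this
      have h2 : gibbs β s (siteSpin {i, j}) = gibbs β s (fun σ => bondSpin σ s(i, j)) := by
        congr 1
        funext σ
        rw [siteSpin_pair, bondSpin_mk]
      rw [h2] at this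
      linarith
  have hb := abs_le.1 (abs_gibbs_le β s fun σ => (abs_bondSpin σ e).le)
  have hs := Real.sinh_nonneg_iff.2 hβ
  have hlow : Real.exp (-β) ≤ Real.cosh β + Real.sinh β * gibbs β s (fun σ => bondSpin σ e) := by
    rw [← Real.cosh_sub_sinh]
    nlinarith [hb.1]
  have hup : Real.cosh β + Real.sinh β * gibbs β s (fun σ => bondSpin σ e) ≤ Real.exp β := by
    rw [← Real.cosh_add_sinh]
    nlinarith [hb.2]
  have hpos := (Real.exp_pos (-β)).trans_le hlow
  rw [gibbs_cons, div_sub' hpos.ne', le_div_iff₀ hpos]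
  have h1 : Real.exp (-β) * (Real.cosh β + Real.sinh β * gibbs β s (fun σ => bondSpin σ e)) ≤ 1 := by
    calc _ ≤ Real.exp (-β) * Real.exp β := mul_le_mul_of_nonneg_left hup (Real.exp_pos _).le
      _ = 1 := by rw [← Real.exp_add]; simp
  nlinarith [mul_le_mul_of_nonneg_left h1 (mul_nonneg hs hcov)]

theorem gibbs_siteSpin_le_cons {β : ℝ} (hβ : 0 ≤ β) (s : Multiset (Sym2 ι)) (e : Sym2 ι)
    (t : Multiset ι) : gibbs β s (siteSpin t) ≤ gibbs β (e ::ₘ s) (siteSpin t) := by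
  have h := gibbs_siteSpin_cons_sub_ge hβ s e t
  have hcov : 0 ≤ gibbs β s (fun σ => siteSpin t σ * bondSpin σ e) -
      gibbs β s (siteSpin t) * gibbs β s (fun σ => bondSpin σ e) := by
    induction e using Sym2.ind with
    | _ i j =>
      have := gibbs_siteSpin_mul_le hβ s t {i, j}
      have h2 : siteSpin {i, j} = fun σ => bondSpin σ s(i, j) := by
        funext σ
        rw [siteSpin_pair, bondSpin_mk]
      rw [h2] at this
      linarith
  have := mul_nonneg (mul_nonneg (Real.sinh_nonneg_iff.2 hβ) (Real.exp_pos (-β)).le) hcov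
  linarith

theorem gibbs_siteSpin_le_add {β : ℝ} (hβ : 0 ≤ β) (s r : Multiset (Sym2 ι)) (t : Multiset ι) :
    gibbs β s (siteSpin t) ≤ gibbs β (s + r) (siteSpin t) := by
  induction r using Multiset.induction_on with
  | empty => simp
  | cons e r ih =>
    rw [Multiset.add_cons]
    exact ih.trans (gibbs_siteSpin_le_cons hβ _ e t)

end Gibbs

section Magnetization

/-- The magnetization of the first `N` spins of a system of `N + 1` spins. -/
noncomputable def mag (N : ℕ) (σ : Option (Fin N) → Bool) : ℝ :=
  (N : ℝ)⁻¹ * ∑ x : Fin N, spin (σ (some x))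

/-- The variance of the squared magnetization. -/
noncomputable def magVar (N : ℕ) (β : ℝ) (s : Multiset (Sym2 (Option (Fin N)))) : ℝ :=
  gibbs β s (fun σ => mag N σ ^ 4) - gibbs β s (fun σ => mag N σ ^ 2) ^ 2

theorem mag_sq (N : ℕ) (σ : Option (Fin N) → Bool) :
    mag N σ ^ 2 = ((N : ℝ) ^ 2)⁻¹ * ∑ x : Fin N, ∑ y : Fin N, siteSpin {some x, some y} σ := by
  simp only [mag, siteSpin_pair, mul_pow, inv_pow]
  rw [sq (∑ x : Fin N, _), Finset.sum_mul_sum]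

theorem gibbs_mag_sq (N : ℕ) (β : ℝ) (s : Multiset (Sym2 (Option (Fin N)))) :
    gibbs β s (fun σ => mag N σ ^ 2) =
      ((N : ℝ) ^ 2)⁻¹ * ∑ x : Fin N, ∑ y : Fin N, gibbs β s (siteSpin {some x, some y}) := by
  simp only [mag_sq, gibbs_const_mul, gibbs_sum]

theorem abs_mag_le (N : ℕ) (σ : Option (Fin N) → Bool) : |mag N σ| ≤ 1 := by
  rw [mag, abs_mul, abs_inv, Nat.abs_cast]
  have h : |∑ x : Fin N, spin (σ (some x))| ≤ N := by
    refine (Finset.abs_sum_le_sum_abs _ _).trans ?_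
    simp [abs_spin]
  exact inv_mul_le_one_of_le₀ h (Nat.cast_nonneg N)

theorem magVar_eq (N : ℕ) (β : ℝ) (s : Multiset (Sym2 (Option (Fin N)))) :
    magVar N β s =
      gibbs β s (fun σ => (mag N σ ^ 2 - gibbs β s (fun σ => mag N σ ^ 2)) ^ 2) := by
  set y := gibbs β s (fun σ => mag N σ ^ 2) with hy
  have h : (fun σ => (mag N σ ^ 2 - y) ^ 2) =
      fun σ => (mag N σ ^ 4 + (-(2 * y)) * mag N σ ^ 2) + y ^ 2 := by
    funext σ
    ring
  rw [h, gibbs_add, gibbs_add, gibbs_const_mul, gibbs_const, magVar, ← hy]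
  ring

theorem magVar_nonneg (N : ℕ) (β : ℝ) (s : Multiset (Sym2 (Option (Fin N)))) :
    0 ≤ magVar N β s := by
  rw [magVar_eq]
  exact gibbs_nonneg β s fun σ => sq_nonneg _

theorem magVar_le_one (N : ℕ) (β : ℝ) (s : Multiset (Sym2 (Option (Fin N)))) :
    magVar N β s ≤ 1 := by
  have h : gibbs β s (fun σ => mag N σ ^ 4) ≤ 1 := by
    refine (le_abs_self _).trans (abs_gibbs_le β s fun σ => ?_)
    rw [abs_pow]
    exact pow_le_one₀ (abs_nonneg _) (abs_mag_le N σ)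
  have := sq_nonneg (gibbs β s (fun σ => mag N σ ^ 2))
  rw [magVar]
  linarith

/-- A random bond raises the mean squared magnetization by at least a multiple of its variance. -/
theorem magVar_le (N : ℕ) {β : ℝ} (hβ : 0 ≤ β) (s : Multiset (Sym2 (Option (Fin N)))) :
    Real.sinh β * Real.exp (-β) * magVar N β s ≤
      ((N : ℝ) ^ 2)⁻¹ * ∑ i : Fin N, ∑ j : Fin N,
        (gibbs β (s(some i, some j) ::ₘ s) (fun σ => mag N σ ^ 2) -
          gibbs β s (fun σ => mag N σ ^ 2)) := by
  have hN : (0 : ℝ) ≤ ((N : ℝ) ^ 2)⁻¹ := by positivity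
  have hstep : ∀ e : Sym2 (Option (Fin N)), Real.sinh β * Real.exp (-β) *
      (gibbs β s (fun σ => mag N σ ^ 2 * bondSpin σ e) -
        gibbs β s (fun σ => mag N σ ^ 2) * gibbs β s (fun σ => bondSpin σ e)) ≤
      gibbs β (e ::ₘ s) (fun σ => mag N σ ^ 2) - gibbs β s (fun σ => mag N σ ^ 2) := by
    intro e
    have h1 : gibbs β s (fun σ => mag N σ ^ 2 * bondSpin σ e) = ((N : ℝ) ^ 2)⁻¹ *
        ∑ x : Fin N, ∑ y : Fin N,
          gibbs β s (fun σ => siteSpin {some x, some y} σ * bondSpin σ e) := by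
      simp only [mag_sq, mul_assoc, gibbs_const_mul, Finset.sum_mul, gibbs_sum]
    rw [h1, gibbs_mag_sq, gibbs_mag_sq, mul_assoc (_⁻¹), ← mul_sub, ← mul_sub, Finset.sum_mul,
      ← Finset.sum_sub_distrib, ← Finset.sum_sub_distrib, mul_left_comm]
    refine mul_le_mul_of_nonneg_left ?_ hN
    rw [Finset.mul_sum]
    refine Finset.sum_le_sum fun x _ => ?_
    rw [Finset.sum_mul, ← Finset.sum_sub_distrib, ← Finset.sum_sub_distrib, Finset.mul_sum]
    exact Finset.sum_le_sum fun y _ => gibbs_siteSpin_cons_sub_ge hβ s e _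
  have hsq : ∀ σ : Option (Fin N) → Bool, mag N σ ^ 2 =
      ((N : ℝ) ^ 2)⁻¹ * ∑ i : Fin N, ∑ j : Fin N, bondSpin σ s(some i, some j) := by
    intro σ
    simp only [mag_sq, siteSpin_pair, bondSpin_mk]
  have hvar : magVar N β s = ((N : ℝ) ^ 2)⁻¹ * ∑ i : Fin N, ∑ j : Fin N,
      (gibbs β s (fun σ => mag N σ ^ 2 * bondSpin σ s(some i, some j)) -
        gibbs β s (fun σ => mag N σ ^ 2) * gibbs β s (fun σ => bondSpin σ s(some i, some j))) := by
    simp only [Finset.sum_sub_distrib, ← Finset.mul_sum]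
    rw [mul_sub, magVar]
    congr 1
    · simp only [← gibbs_sum, ← Finset.mul_sum, ← gibbs_const_mul]
      congr 1
      funext σ
      rw [mul_left_comm, ← hsq σ]
      ring
    · rw [mul_left_comm, sq]
      simp only [← gibbs_sum, ← gibbs_const_mul]
      congr 2
      funext σ
      rw [hsq σ]
  rw [hvar, mul_left_comm]
  refine mul_le_mul_of_nonneg_left ?_ hN
  rw [Finset.mul_sum]
  refine Finset.sum_le_sum fun i _ => ?_
  rw [Finset.mul_sum]
  exact Finset.sum_le_sum fun j _ => hstep _

/-- Adding bonds changes the mean squared magnetization little if its variance is small. -/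
theorem gibbs_mag_sq_add_sub_le (N : ℕ) {β ε : ℝ} (hβ : 0 ≤ β) (hε : 0 < ε)
    (s t : Multiset (Sym2 (Option (Fin N)))) :
    gibbs β (s + t) (fun σ => mag N σ ^ 2) - gibbs β s (fun σ => mag N σ ^ 2) ≤
      ε / 2 + Real.exp (2 * β * t.card) * magVar N β s / (2 * ε) := by
  set y := gibbs β s (fun σ => mag N σ ^ 2) with hy
  have h1 : gibbs β (s + t) (fun σ => mag N σ ^ 2) ≤
      gibbs β (s + t) (fun σ => (y + ε / 2) + (2 * ε)⁻¹ * (mag N σ ^ 2 - y) ^ 2) := by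
    refine gibbs_mono β _ fun σ => ?_
    have h : (y + ε / 2) + (2 * ε)⁻¹ * (mag N σ ^ 2 - y) ^ 2 - mag N σ ^ 2 =
        (2 * ε)⁻¹ * (mag N σ ^ 2 - y - ε) ^ 2 := by
      field_simp
      ring
    have : 0 ≤ (2 * ε)⁻¹ * (mag N σ ^ 2 - y - ε) ^ 2 := by positivity
    linarith
  rw [gibbs_add, gibbs_const, gibbs_const_mul] at h1
  have h2 := gibbs_add_le hβ s t (g := fun σ => (mag N σ ^ 2 - y) ^ 2) fun σ => sq_nonneg _
  rw [hy, ← magVar_eq, ← hy] at h2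
  have h3 := mul_le_mul_of_nonneg_left h2 (show 0 ≤ (2 * ε)⁻¹ by positivity)
  rw [div_eq_inv_mul _ (2 * ε)]
  linarith

end Magnetization

section PoissonWeights

theorem pois_nonneg {lam : ℝ} (h : 0 ≤ lam) (k : ℕ) : 0 ≤ pois lam k := by
  unfold pois
  positivity

theorem hasSum_exp_mul_pow_div_factorial (a x : ℝ) :
    HasSum (fun k : ℕ => Real.exp a * x ^ k / (Nat.factorial k)) (Real.exp (a + x)) := by
  have h := (NormedSpace.expSeries_div_hasSum_exp (𝔸 := ℝ) x).mul_left (Real.exp a)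
  rw [← Real.exp_eq_exp_ℝ, ← Real.exp_add] at h
  simpa only [mul_div_assoc] using h

theorem hasSum_pois (lam : ℝ) : HasSum (pois lam) 1 := by
  have h := hasSum_exp_mul_pow_div_factorial (-lam) lam
  rwa [neg_add_cancel, Real.exp_zero] at h

theorem hasSum_pois_mul_exp (lam c : ℝ) :
    HasSum (fun k : ℕ => pois lam k * Real.exp (c * k)) (Real.exp (lam * (Real.exp c - 1))) := by
  have h := hasSum_exp_mul_pow_div_factorial (-lam) (lam * Real.exp c)
  rw [show -lam + lam * Real.exp c = lam * (Real.exp c - 1) by ring] at h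
  refine h.congr_fun fun k => ?_
  rw [pois, mul_pow, mul_comm c, Real.exp_nat_mul]
  ring

theorem summable_pois_mul {lam : ℝ} (h : 0 ≤ lam) {a : ℕ → ℝ} {C : ℝ} (ha : ∀ k, |a k| ≤ C) :
    Summable fun k => pois lam k * a k := by
  refine Summable.of_norm_bounded ((hasSum_pois lam).summable.mul_right C) fun k => ?_
  rw [Real.norm_eq_abs, abs_mul, abs_of_nonneg (pois_nonneg h k)]
  exact mul_le_mul_of_nonneg_left (ha k) (pois_nonneg h k)

/-- Poisson averages of a bounded sequence vary little with the mean. -/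
theorem abs_tsum_pois_sub_le {lam mu η : ℝ} (hlam : 0 < lam) (hmu : 0 ≤ mu) (hη : 0 < η)
    {a : ℕ → ℝ} (ha : ∀ k, |a k| ≤ 1) :
    |∑' k, pois mu k * a k - ∑' k, pois lam k * a k| ≤
      η / 2 + (Real.exp ((mu - lam) ^ 2 / lam) - 1) / (2 * η) := by
  have hchi : HasSum (fun k : ℕ => pois lam k * (mu ^ k * Real.exp (lam - mu) / lam ^ k - 1) ^ 2)
      (Real.exp ((mu - lam) ^ 2 / lam) - 1) := by
    have h1 := hasSum_exp_mul_pow_div_factorial (lam - 2 * mu) (mu ^ 2 / lam)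
    rw [show lam - 2 * mu + mu ^ 2 / lam = (mu - lam) ^ 2 / lam by field_simp; ring] at h1
    have h2 := (h1.sub ((hasSum_pois mu).mul_left 2)).add (hasSum_pois lam)
    rw [show Real.exp ((mu - lam) ^ 2 / lam) - 2 * 1 + 1 = Real.exp ((mu - lam) ^ 2 / lam) - 1 by
      ring] at h2
    refine h2.congr_fun fun k => ?_
    have e1 : Real.exp (lam - 2 * mu) = Real.exp (-lam) * Real.exp (lam - mu) ^ 2 := by
      rw [sq, ← Real.exp_add, ← Real.exp_add]
      congr 1
      ring
    have e2 : Real.exp (-mu) = Real.exp (-lam) * Real.exp (lam - mu) := by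
      rw [← Real.exp_add]
      congr 1
      ring
    simp only [pois]
    rw [e1, e2, div_pow, ← pow_mul]
    have : lam ^ k ≠ 0 := pow_ne_zero _ hlam.ne'
    have : (Nat.factorial k : ℝ) ≠ 0 := Nat.cast_ne_zero.2 (Nat.factorial_ne_zero k)
    field_simp
    ring
  have hbound := ((hasSum_pois lam).mul_right (η / 2)).add (hchi.mul_right (2 * η)⁻¹)
  rw [one_mul, ← div_eq_mul_inv] at hbound
  rw [← (summable_pois_mul hmu ha).tsum_sub (summable_pois_mul hlam.le ha), ← Real.norm_eq_abs]
  refine tsum_of_norm_bounded hbound fun k => ?_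
  have hρ : pois mu k = pois lam k * (mu ^ k * Real.exp (lam - mu) / lam ^ k) := by
    have e2 : Real.exp (-mu) = Real.exp (-lam) * Real.exp (lam - mu) := by
      rw [← Real.exp_add]
      congr 1
      ring
    rw [pois, pois, e2]
    have : lam ^ k ≠ 0 := pow_ne_zero _ hlam.ne'
    field_simp
  rw [hρ]
  set ρ := mu ^ k * Real.exp (lam - mu) / lam ^ k
  rw [show pois lam k * ρ * a k - pois lam k * a k = pois lam k * ((ρ - 1) * a k) by ring,
    Real.norm_eq_abs, abs_mul, abs_of_nonneg (pois_nonneg hlam.le k), abs_mul, mul_assoc, ← mul_add]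
  refine mul_le_mul_of_nonneg_left ?_ (pois_nonneg hlam.le k)
  have h3 : |ρ - 1| * |a k| ≤ |ρ - 1| := mul_le_of_le_one_right (abs_nonneg _) (ha k)
  have h4 : η / 2 + (ρ - 1) ^ 2 * (2 * η)⁻¹ - |ρ - 1| = (2 * η)⁻¹ * (|ρ - 1| - η) ^ 2 := by
    rw [← sq_abs (ρ - 1)]
    field_simp
    ring
  have h5 : 0 ≤ (2 * η)⁻¹ * (|ρ - 1| - η) ^ 2 := by positivity
  linarith

end PoissonWeights

section PoissonSemigroup

open BoundedContinuousFunction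

local instance multisetTopology (E : Type*) : TopologicalSpace (Multiset E) := ⊥

local instance multisetDiscrete (E : Type*) : DiscreteTopology (Multiset E) := ⟨rfl⟩

variable {E : Type*}

/-- Bounded functions of a multiset. -/
def Obs (E : Type*) : Type _ := Multiset E →ᵇ ℝ

noncomputable instance : NormedAddCommGroup (Obs E) :=
  inferInstanceAs (NormedAddCommGroup (Multiset E →ᵇ ℝ))

noncomputable instance : NormedSpace ℝ (Obs E) :=
  inferInstanceAs (NormedSpace ℝ (Multiset E →ᵇ ℝ))

instance : CompleteSpace (Obs E) := inferInstanceAs (CompleteSpace (Multiset E →ᵇ ℝ))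

instance : FunLike (Obs E) (Multiset E) ℝ := inferInstanceAs (FunLike (Multiset E →ᵇ ℝ) _ _)

/-- A function of a multiset that is bounded in absolute value by `C`. -/
noncomputable def Obs.ofBounded (f : Multiset E → ℝ) (C : ℝ) (hf : ∀ s, |f s| ≤ C) : Obs E :=
  ofNormedAddCommGroupDiscrete f C hf

/-- The value of a function at a multiset. -/
noncomputable def evalAt (s : Multiset E) : Obs E →L[ℝ] ℝ :=
  BoundedContinuousFunction.evalCLM ℝ s

/-- The operator that evaluates a function after the addition of one element. -/
noncomputable def addElem (e : E) : Obs E →L[ℝ] Obs E :=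
  compContinuousCLM ℝ ℝ
    (⟨fun s => e ::ₘ s, continuous_of_discreteTopology⟩ : C(Multiset E, Multiset E))

/-- The operator that evaluates a function after a relabelling of the elements. -/
noncomputable def relabel (φ : E → E) : Obs E →L[ℝ] Obs E :=
  compContinuousCLM ℝ ℝ
    (⟨fun s => s.map φ, continuous_of_discreteTopology⟩ : C(Multiset E, Multiset E))

theorem Obs.ext {F G : Obs E} (h : ∀ s, F s = G s) : F = G := DFunLike.ext F G h

theorem evalAt_apply (s : Multiset E) (F : Obs E) : evalAt s F = F s := rfl

theorem Obs.sub_apply (F G : Obs E) (s : Multiset E) : (F - G) s = F s - G s := rfl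

theorem Obs.smul_apply (c : ℝ) (F : Obs E) (s : Multiset E) : (c • F) s = c * F s := rfl

theorem Obs.sum_apply {κ : Type*} (K : Finset κ) (F : κ → Obs E) (s : Multiset E) :
    (∑ k ∈ K, F k) s = ∑ k ∈ K, F k s := map_sum (evalAt s) F K

theorem addElem_apply (e : E) (F : Obs E) (s : Multiset E) : addElem e F s = F (e ::ₘ s) := rfl

theorem relabel_apply (φ : E → E) (F : Obs E) (s : Multiset E) :
    relabel φ F s = F (s.map φ) := rfl

theorem commute_addElem (e e' : E) : Commute (addElem e) (addElem e') := by
  refine ContinuousLinearMap.ext fun F => Obs.ext fun s => ?_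
  change F (e' ::ₘ e ::ₘ s) = F (e ::ₘ e' ::ₘ s)
  rw [Multiset.cons_swap]

/-- The average of a function over the addition of one uniformly chosen element. -/
noncomputable def avgElem {κ : Type*} [Fintype κ] (c : κ → E) : Obs E →L[ℝ] Obs E :=
  (Fintype.card κ : ℝ)⁻¹ • ∑ k, addElem (c k)

/-- The average of a function over the application of `A` a Poisson number of times. -/
noncomputable def poissonExp (lam : ℝ) (A : Obs E →L[ℝ] Obs E) : Obs E →L[ℝ] Obs E :=
  Real.exp (-lam) • NormedSpace.exp (lam • A)

theorem hasSum_exp_smul_apply (lam : ℝ) (A : Obs E →L[ℝ] Obs E) (F : Obs E) (s : Multiset E) :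
    HasSum (fun k : ℕ => lam ^ k / (Nat.factorial k) * (A ^ k) F s)
      (NormedSpace.exp (lam • A) F s) := by
  have h := NormedSpace.exp_series_hasSum_exp' (𝕂 := ℝ) (lam • A)
  have h2 := h.mapL ((evalAt s).comp (ContinuousLinearMap.apply ℝ (Obs E) F))
  refine h2.congr_fun fun k => ?_
  simp [smul_pow, evalAt_apply]
  ring

theorem hasSum_poissonExp (lam : ℝ) (A : Obs E →L[ℝ] Obs E) (F : Obs E) (s : Multiset E) :
    HasSum (fun k : ℕ => pois lam k * (A ^ k) F s) (poissonExp lam A F s) := by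
  have h := (hasSum_exp_smul_apply lam A F s).mul_left (Real.exp (-lam))
  refine h.congr_fun fun k => ?_
  rw [pois]
  ring

theorem poissonExp_add (lam mu : ℝ) (A : Obs E →L[ℝ] Obs E) :
    poissonExp (lam + mu) A = poissonExp lam A * poissonExp mu A := by
  let _ : NormedAlgebra ℚ (Obs E →L[ℝ] Obs E) := NormedAlgebra.restrictScalars ℚ ℝ _
  rw [poissonExp, poissonExp, poissonExp, smul_mul_smul_comm, ← Real.exp_add, neg_add, add_smul,
    NormedSpace.exp_add_of_commute (((Commute.refl A).smul_left _).smul_right _)]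

theorem avgElem_apply {κ : Type*} [Fintype κ] (c : κ → E) (F : Obs E) (s : Multiset E) :
    avgElem c F s = (Fintype.card κ : ℝ)⁻¹ * ∑ k, F (c k ::ₘ s) := by
  simp [avgElem, addElem_apply, Obs.smul_apply, Obs.sum_apply]

theorem avgElem_pow_apply {κ : Type*} [Fintype κ] (c : κ → E) (k : ℕ) (F : Obs E)
    (s : Multiset E) : (avgElem c ^ k) F s =
      ((Fintype.card κ : ℝ) ^ k)⁻¹ * ∑ f : Fin k → κ, F (s + ∑ ν, {c (f ν)}) := by
  induction k generalizing s with
  | zero => simp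
  | succ k ih =>
    rw [pow_succ']
    change avgElem c ((avgElem c ^ k) F) s = _
    rw [avgElem_apply]
    simp only [ih]
    rw [← Finset.mul_sum, ← mul_assoc, ← mul_inv, ← pow_succ',
      ← (Fin.consEquiv fun _ : Fin (k + 1) => κ).sum_comp, Fintype.sum_prod_type]
    congr 1
    refine Finset.sum_congr rfl fun x _ => Finset.sum_congr rfl fun f _ => ?_
    congr 1
    simp only [Fin.sum_univ_succ, Fin.consEquiv_apply, Fin.cons_zero, Fin.cons_succ]
    rw [← Multiset.singleton_add]
    abel

theorem avgElem_pow_mono {κ : Type*} [Fintype κ] (c : κ → E) (k : ℕ) {F G : Obs E}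
    (h : ∀ s, F s ≤ G s) (s : Multiset E) : (avgElem c ^ k) F s ≤ (avgElem c ^ k) G s := by
  rw [avgElem_pow_apply, avgElem_pow_apply]
  exact mul_le_mul_of_nonneg_left (Finset.sum_le_sum fun k _ => h _) (by positivity)

theorem abs_avgElem_pow_le {κ : Type*} [Fintype κ] (c : κ → E) (k : ℕ) {F : Obs E} {C : ℝ}
    (h : ∀ s, |F s| ≤ C) (s : Multiset E) : |(avgElem c ^ k) F s| ≤ C := by
  rcases isEmpty_or_nonempty (Fin k → κ) with h0 | h0
  · rw [avgElem_pow_apply]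
    simpa using (abs_nonneg _).trans (h 0)
  · have hpos : (0 : ℝ) < (Fintype.card κ : ℝ) ^ k := by
      have : 0 < Fintype.card (Fin k → κ) := Fintype.card_pos
      rw [Fintype.card_fun, Fintype.card_fin] at this
      exact_mod_cast this
    rw [avgElem_pow_apply, abs_mul, abs_inv, abs_of_pos hpos, inv_mul_le_iff₀ hpos]
    refine (Finset.abs_sum_le_sum_abs _ _).trans ((Finset.sum_le_sum fun f _ => h _).trans ?_)
    simp

theorem poissonExp_avgElem_mono {κ : Type*} [Fintype κ] {lam : ℝ} (hlam : 0 ≤ lam) (c : κ → E)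
    {F G : Obs E} (h : ∀ s, F s ≤ G s) (s : Multiset E) :
    poissonExp lam (avgElem c) F s ≤ poissonExp lam (avgElem c) G s :=
  hasSum_le (fun k => mul_le_mul_of_nonneg_left (avgElem_pow_mono c k h s) (pois_nonneg hlam k))
    (hasSum_poissonExp _ _ _ _) (hasSum_poissonExp _ _ _ _)

theorem abs_poissonExp_avgElem_le {κ : Type*} [Fintype κ] {lam : ℝ} (hlam : 0 ≤ lam) (c : κ → E)
    {F : Obs E} {C : ℝ} (h : ∀ s, |F s| ≤ C) (s : Multiset E) :
    |poissonExp lam (avgElem c) F s| ≤ C := by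
  rw [← (hasSum_poissonExp _ _ _ _).tsum_eq, ← Real.norm_eq_abs]
  have hb := (hasSum_pois lam).mul_right C
  rw [one_mul] at hb
  refine tsum_of_norm_bounded hb fun k => ?_
  rw [Real.norm_eq_abs, abs_mul, abs_of_nonneg (pois_nonneg hlam k)]
  exact mul_le_mul_of_nonneg_left (abs_avgElem_pow_le c k h s) (pois_nonneg hlam k)

/-- If adding elements increases `F`, a Poisson number of additions increases `F` by at least the
contribution of a single addition. -/
theorem le_poissonExp_avgElem_sub {κ : Type*} [Fintype κ] [Nonempty κ] {lam : ℝ} (hlam : 0 ≤ lam)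
    (c : κ → E) {F : Obs E} (h : ∀ s t, F s ≤ F (s + t)) (s : Multiset E) :
    pois lam 1 * (avgElem c F s - F s) ≤ poissonExp lam (avgElem c) F s - F s := by
  have h1 := hasSum_poissonExp lam (avgElem c) F s
  have h2 := (hasSum_pois lam).mul_right (F s)
  rw [one_mul] at h2
  have hs := h1.sub h2
  refine le_trans ?_ (le_hasSum hs 1 fun k _ => ?_)
  · simp [mul_sub]
  · rw [← mul_sub]
    refine mul_nonneg (pois_nonneg hlam k) (sub_nonneg.2 ?_)
    have hpos : (0 : ℝ) < (Fintype.card κ : ℝ) ^ k := by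
      have : 0 < Fintype.card κ := Fintype.card_pos
      positivity
    rw [avgElem_pow_apply, inv_mul_eq_div, le_div_iff₀ hpos]
    calc F s * (Fintype.card κ : ℝ) ^ k = ∑ f : Fin k → κ, F s := by
          simp [mul_comm]
      _ ≤ _ := Finset.sum_le_sum fun f _ => h _ _

end PoissonSemigroup

section Exchange

variable {ι : Type*} [Fintype ι] [DecidableEq ι]

/-- The `n`-th power of the correlation of the spins at two sites. -/
noncomputable def corrPow (β : ℝ) (n : ℕ) (i j : ι) : Obs (Sym2 ι) :=
  Obs.ofBounded (fun s => gibbs β s (siteSpin {i, j}) ^ n) 1 fun s => by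
    rw [abs_pow]
    exact pow_le_one₀ (abs_nonneg _) (abs_gibbs_siteSpin_le β s _)

theorem corrPow_apply (β : ℝ) (n : ℕ) (i j : ι) (s : Multiset (Sym2 ι)) :
    corrPow β n i j s = gibbs β s (siteSpin {i, j}) ^ n := rfl

theorem abs_corrPow_le (β : ℝ) (n : ℕ) (i j : ι) (s : Multiset (Sym2 ι)) :
    |corrPow β n i j s| ≤ 1 := by
  rw [corrPow_apply, abs_pow]
  exact pow_le_one₀ (abs_nonneg _) (abs_gibbs_siteSpin_le β s _)

omit [Fintype ι] [DecidableEq ι] in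
theorem bondWeight_map (β : ℝ) (π : Equiv.Perm ι) (s : Multiset (Sym2 ι)) (σ : ι → Bool) :
    bondWeight β (s.map (Sym2.map π)) σ = bondWeight β s (fun i => σ (π i)) := by
  have h : ∀ e : Sym2 ι, bondSpin σ (Sym2.map π e) = bondSpin (fun i => σ (π i)) e := by
    intro e
    induction e using Sym2.ind with
    | _ i j => rfl
  simp only [bondWeight, bondSum, Multiset.map_map, Function.comp_def, h]

theorem gibbs_map (β : ℝ) (π : Equiv.Perm ι) (s : Multiset (Sym2 ι)) (g : (ι → Bool) → ℝ) :
    gibbs β (s.map (Sym2.map π)) (fun σ => g fun i => σ (π i)) = gibbs β s g := by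
  have h := fun f : (ι → Bool) → ℝ => (Equiv.arrowCongr π.symm (Equiv.refl Bool)).sum_comp f
  simp only [gibbs, bondWeight_map]
  congr 1
  · exact h fun σ => g σ * bondWeight β s σ
  · exact h fun σ => bondWeight β s σ

theorem relabel_corrPow (β : ℝ) (n : ℕ) (π : Equiv.Perm ι) (i j : ι) :
    relabel (Sym2.map π) (corrPow β n (π i) (π j)) = corrPow β n i j := by
  refine Obs.ext fun s => ?_
  have h : siteSpin {π i, π j} = fun σ : ι → Bool => siteSpin {i, j} fun k => σ (π k) := by
    funext σ
    rw [siteSpin_pair, siteSpin_pair]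
  rw [relabel_apply, corrPow_apply, corrPow_apply, h, gibbs_map β π s]

theorem addElem_loop_corrPow (β : ℝ) (n : ℕ) (k i j : ι) :
    addElem s(k, k) (corrPow β n i j) = corrPow β n i j := by
  refine Obs.ext fun s => ?_
  have h : ∀ σ : ι → Bool, bondWeight β (s(k, k) ::ₘ s) σ = Real.exp β * bondWeight β s σ := by
    intro σ
    rw [bondWeight_cons, bondSpin_mk, spin_mul_self, one_mul, Real.cosh_add_sinh]
  rw [addElem_apply, corrPow_apply, corrPow_apply]
  simp only [gibbs, h, mul_left_comm _ (Real.exp β), ← Finset.mul_sum]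
  rw [mul_div_mul_left _ _ (Real.exp_pos β).ne']

/-- The sum of the additions of all bonds, loops included. -/
noncomputable def sumBonds (ι : Type*) [Fintype ι] : Obs (Sym2 ι) →L[ℝ] Obs (Sym2 ι) :=
  ∑ i : ι, ∑ j : ι, addElem s(i, j)

omit [DecidableEq ι] in
theorem commute_relabel_sumBonds (π : Equiv.Perm ι) :
    Commute (relabel (Sym2.map π)) (sumBonds ι) := by
  have h : ∀ i j : ι, relabel (Sym2.map π) * addElem s(π i, π j) =
      addElem s(i, j) * relabel (Sym2.map π) := by
    intro i j
    refine ContinuousLinearMap.ext fun F => Obs.ext fun s => ?_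
    change F (s(π i, π j) ::ₘ s.map (Sym2.map π)) = F ((s(i, j) ::ₘ s).map (Sym2.map π))
    rw [Multiset.map_cons, Sym2.map_mk]
  have h2 : sumBonds ι = ∑ i : ι, ∑ j : ι, addElem s(π i, π j) := by
    rw [sumBonds, ← Equiv.sum_comp π]
    exact Finset.sum_congr rfl fun i _ => (Equiv.sum_comp π _).symm
  have h3 : relabel (Sym2.map π) * sumBonds ι = sumBonds ι * relabel (Sym2.map π) := by
    conv_lhs => rw [h2]
    simp only [sumBonds, Finset.mul_sum, Finset.sum_mul, h]
  exact h3

/-- Correlations averaged over the symmetric bond process do not depend on the sites. -/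
theorem exp_sumBonds_corrPow (r β : ℝ) (n : ℕ) (π : Equiv.Perm ι) (i j : ι) :
    NormedSpace.exp (r • sumBonds ι) (corrPow β n (π i) (π j)) 0 =
      NormedSpace.exp (r • sumBonds ι) (corrPow β n i j) 0 := by
  let _ : NormedAlgebra ℚ (Obs (Sym2 ι) →L[ℝ] Obs (Sym2 ι)) :=
    NormedAlgebra.restrictScalars ℚ ℝ _
  have h := ((commute_relabel_sumBonds π).smul_right r).exp_right
  have h2 := DFunLike.congr_fun (DFunLike.congr_fun h.eq (corrPow β n (π i) (π j)))
    (0 : Multiset (Sym2 ι))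
  change NormedSpace.exp (r • sumBonds ι) (corrPow β n (π i) (π j))
      ((0 : Multiset (Sym2 ι)).map (Sym2.map π)) =
    NormedSpace.exp (r • sumBonds ι) (relabel (Sym2.map π) (corrPow β n (π i) (π j))) 0 at h2
  rwa [relabel_corrPow, Multiset.map_zero] at h2

end Exchange

section Cavity

variable {N : ℕ}

/-- The average over the addition of one bond between sites other than the cavity site. -/
noncomputable def avgBase (N : ℕ) :
    Obs (Sym2 (Option (Fin N))) →L[ℝ] Obs (Sym2 (Option (Fin N))) :=
  avgElem fun ij : Fin N × Fin N => s(some ij.1, some ij.2)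

/-- The average over the addition of one bond between the cavity site and another site. -/
noncomputable def avgStar (N : ℕ) :
    Obs (Sym2 (Option (Fin N))) →L[ℝ] Obs (Sym2 (Option (Fin N))) :=
  avgElem fun i : Fin N => s(some i, none)

theorem smul_avgBase (hN : N ≠ 0) (r : ℝ) :
    (r * (N : ℝ) ^ 2) • avgBase N = r • ∑ i : Fin N, ∑ j : Fin N, addElem s(some i, some j) := by
  have : (N : ℝ) ≠ 0 := Nat.cast_ne_zero.2 hN
  rw [avgBase, avgElem, smul_smul, Fintype.sum_prod_type, Fintype.card_prod, Fintype.card_fin]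
  congr 1
  push_cast
  field_simp

theorem smul_avgStar (hN : N ≠ 0) (r : ℝ) :
    (2 * r * (N : ℝ)) • avgStar N = r • (2 : ℝ) • ∑ i : Fin N, addElem s(some i, none) := by
  have : (N : ℝ) ≠ 0 := Nat.cast_ne_zero.2 hN
  rw [avgStar, avgElem, smul_smul, smul_smul, Fintype.card_fin]
  congr 1
  field_simp

theorem smul_sumBonds (hN : N ≠ 0) (r : ℝ) :
    r • sumBonds (Option (Fin N)) =
      ((r * (N : ℝ) ^ 2) • avgBase N + (2 * r * (N : ℝ)) • avgStar N) +
        r • addElem s(none, none) := by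
  rw [smul_avgBase hN, smul_avgStar hN, ← smul_add, ← smul_add]
  congr 1
  simp only [sumBonds, Fintype.sum_option, Finset.sum_add_distrib, two_smul]
  have h : ∀ i : Fin N, (s(none, some i) : Sym2 (Option (Fin N))) = s(some i, none) :=
    fun i => Sym2.eq_swap
  simp only [h]
  abel

theorem commute_avgElem {E κ μ : Type*} [Fintype κ] [Fintype μ] (c : κ → E) (d : μ → E) :
    Commute (avgElem c) (avgElem d) :=
  ((Commute.sum_left _ _ _ fun _ _ => Commute.sum_right _ _ _ fun _ _ =>
    commute_addElem _ _).smul_left _).smul_right _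

theorem commute_avgElem_addElem {E κ : Type*} [Fintype κ] (c : κ → E) (e : E) :
    Commute (avgElem c) (addElem e) :=
  (Commute.sum_left _ _ _ fun _ _ => commute_addElem _ _).smul_left _

theorem exp_smul_apply_of_fixed {E : Type*} (r : ℝ) (A : Obs E →L[ℝ] Obs E) (F : Obs E)
    (h : A F = F) : NormedSpace.exp (r • A) F = Real.exp r • F := by
  have hpow : ∀ k : ℕ, (A ^ k) F = F := by
    intro k
    induction k with
    | zero => rfl
    | succ k ih =>
      rw [pow_succ]
      change (A ^ k) (A F) = F
      rw [h, ih]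
  refine Obs.ext fun s => ?_
  have h1 := hasSum_exp_smul_apply r A F s
  simp only [hpow] at h1
  have h2 := (NormedSpace.expSeries_div_hasSum_exp (𝔸 := ℝ) r).mul_right (F s)
  rw [← Real.exp_eq_exp_ℝ] at h2
  exact h1.unique h2

theorem exp_sumBonds_eq (hN : N ≠ 0) (r β : ℝ) (n : ℕ) (i j : Option (Fin N)) :
    NormedSpace.exp (r • sumBonds (Option (Fin N))) (corrPow β n i j) =
      (Real.exp r * Real.exp (r * (N : ℝ) ^ 2) * Real.exp (2 * r * (N : ℝ))) •
        poissonExp (r * (N : ℝ) ^ 2) (avgBase N)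
          (poissonExp (2 * r * (N : ℝ)) (avgStar N) (corrPow β n i j)) := by
  let _ : NormedAlgebra ℚ (Obs (Sym2 (Option (Fin N))) →L[ℝ] Obs (Sym2 (Option (Fin N)))) :=
    NormedAlgebra.restrictScalars ℚ ℝ _
  have h1 : Commute ((r * (N : ℝ) ^ 2) • avgBase N) ((2 * r * (N : ℝ)) • avgStar N) :=
    ((commute_avgElem _ _).smul_left _).smul_right _
  have h2 : Commute ((r * (N : ℝ) ^ 2) • avgBase N + (2 * r * (N : ℝ)) • avgStar N)
      (r • addElem s(none, none)) :=
    (((commute_avgElem_addElem _ _).smul_left _).add_left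
      ((commute_avgElem_addElem _ _).smul_left _)).smul_right _
  rw [smul_sumBonds hN, NormedSpace.exp_add_of_commute h2, NormedSpace.exp_add_of_commute h1,
    poissonExp, poissonExp]
  simp only [mul_apply_eq_comp, smul_apply, map_smul]
  rw [exp_smul_apply_of_fixed r _ _ (addElem_loop_corrPow β n none i j), map_smul, map_smul,
    smul_smul, smul_smul, Real.exp_neg, Real.exp_neg]
  congr 1
  field_simp

theorem poissonExp_corrPow_exchange (hN : N ≠ 0) (r β : ℝ) (n : ℕ) {x y : Fin N} (hxy : x ≠ y) :
    poissonExp (r * (N : ℝ) ^ 2) (avgBase N)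
        (poissonExp (2 * r * (N : ℝ)) (avgStar N) (corrPow β n (some x) none)) 0 =
      poissonExp (r * (N : ℝ) ^ 2) (avgBase N)
        (poissonExp (2 * r * (N : ℝ)) (avgStar N) (corrPow β n (some x) (some y))) 0 := by
  have h := exp_sumBonds_corrPow r β n (Equiv.swap (some y) none) (some x) (some y)
  have hx : (some x : Option (Fin N)) ≠ some y := fun h => hxy (Option.some_injective _ h)
  rw [Equiv.swap_apply_of_ne_of_ne hx (Option.some_ne_none x), Equiv.swap_apply_left,
    exp_sumBonds_eq hN, exp_sumBonds_eq hN, Obs.smul_apply, Obs.smul_apply] at h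
  exact mul_left_cancel₀ (by positivity) h

end Cavity

section Observables

/-- The mean `n`-th power of the correlation with the cavity spin. -/
noncomputable def cavityObs (N : ℕ) (β : ℝ) (n : ℕ) : Obs (Sym2 (Option (Fin N))) :=
  (N : ℝ)⁻¹ • ∑ x : Fin N, corrPow β n (some x) none

/-- The mean `n`-th power of the correlation of two spins other than the cavity spin. -/
noncomputable def pairObs (N : ℕ) (β : ℝ) (n : ℕ) : Obs (Sym2 (Option (Fin N))) :=
  ((N : ℝ) ^ 2)⁻¹ • ∑ x : Fin N, ∑ y : Fin N, corrPow β n (some x) (some y)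

theorem cavityObs_apply (N : ℕ) (β : ℝ) (n : ℕ) (s : Multiset (Sym2 (Option (Fin N)))) :
    cavityObs N β n s = (N : ℝ)⁻¹ * ∑ x : Fin N, gibbs β s (siteSpin {some x, none}) ^ n := by
  simp only [cavityObs, Obs.smul_apply, Obs.sum_apply, corrPow_apply]

theorem pairObs_apply (N : ℕ) (β : ℝ) (n : ℕ) (s : Multiset (Sym2 (Option (Fin N)))) :
    pairObs N β n s = ((N : ℝ) ^ 2)⁻¹ *
      ∑ x : Fin N, ∑ y : Fin N, gibbs β s (siteSpin {some x, some y}) ^ n := by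
  simp only [pairObs, Obs.smul_apply, Obs.sum_apply, corrPow_apply]

/-- The configurations with a cavity spin, parametrized by the cavity spin and by the other spins
relative to it. -/
def gaugeEquiv (N : ℕ) : Bool × (Fin N → Bool) ≃ (Option (Fin N) → Bool) where
  toFun p o := o.elim p.1 fun i => p.2 i == p.1
  invFun τ := (τ none, fun i => τ (some i) == τ none)
  left_inv := by
    rintro ⟨b, σ⟩
    refine Prod.ext rfl (funext fun i => ?_)
    change ((σ i == b) == b) = σ i
    cases σ i <;> cases b <;> rfl
  right_inv := by
    intro τ
    funext o
    cases o with
    | none => rfl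
    | some i =>
      change ((τ (some i) == τ none) == τ none) = τ (some i)
      cases τ (some i) <;> cases τ none <;> rfl

theorem gibbs_eq_of_gauge {N : ℕ} (β : ℝ) (s : Multiset (Sym2 (Option (Fin N))))
    {g : (Option (Fin N) → Bool) → ℝ} {f u : (Fin N → Bool) → ℝ}
    (hg : ∀ p, g (gaugeEquiv N p) = f p.2) (hu : ∀ p, bondSum s (gaugeEquiv N p) = u p.2) :
    gibbs β s g = (∑ σ, f σ * Real.exp (β * u σ)) / ∑ σ, Real.exp (β * u σ) := by
  simp only [gibbs, bondWeight]
  rw [← (gaugeEquiv N).sum_comp, ← (gaugeEquiv N).sum_comp (fun σ => Real.exp (β * bondSum s σ))]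
  simp only [hg, hu, Fintype.sum_prod_type, Finset.sum_const, Finset.card_univ, Fintype.card_bool,
    nsmul_eq_mul]
  rw [mul_div_mul_left _ _ (by norm_num)]

/-- The bonds between sites other than the cavity site. -/
def baseBonds {N k : ℕ} (im : Fin 2 → Fin k → Fin N) : Multiset (Sym2 (Option (Fin N))) :=
  ∑ ν, {s(some (im 0 ν), some (im 1 ν))}

/-- The bonds with the cavity site. -/
def starBonds {N k : ℕ} (im : Fin 1 → Fin k → Fin N) : Multiset (Sym2 (Option (Fin N))) :=
  ∑ ν, {s(some (im 0 ν), none)}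

theorem bondSum_add {ι : Type*} (s t : Multiset (Sym2 ι)) (σ : ι → Bool) :
    bondSum (s + t) σ = bondSum s σ + bondSum t σ := by
  simp [bondSum]

theorem bondSum_sum_singleton {ι κ : Type*} [Fintype κ] (c : κ → Sym2 ι) (σ : ι → Bool) :
    bondSum (∑ k, {c k}) σ = ∑ k, bondSpin σ (c k) := by
  have h := map_sum (Multiset.sumAddMonoidHom.comp (Multiset.mapAddMonoidHom (bondSpin σ)))
    (fun k => ({c k} : Multiset (Sym2 ι))) Finset.univ
  simp only [AddMonoidHom.comp_apply, Multiset.mapAddMonoidHom, AddMonoidHom.coe_mk,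
    ZeroHom.coe_mk, Multiset.coe_sumAddMonoidHom,
    Multiset.map_singleton, Multiset.sum_singleton] at h
  exact h

theorem spin_gauge_some {N : ℕ} (p : Bool × (Fin N → Bool)) (i : Fin N) :
    spin (gaugeEquiv N p (some i)) = spin (p.2 i) * spin p.1 := spin_beq _ _

theorem spin_gauge_none {N : ℕ} (p : Bool × (Fin N → Bool)) :
    spin (gaugeEquiv N p none) = spin p.1 := rfl

theorem spin_gauge_some_some {N : ℕ} (p : Bool × (Fin N → Bool)) (i j : Fin N) :
    spin (gaugeEquiv N p (some i)) * spin (gaugeEquiv N p (some j)) =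
      spin (p.2 i) * spin (p.2 j) := by
  rw [spin_gauge_some, spin_gauge_some, mul_mul_mul_comm, spin_mul_self, mul_one]

theorem spin_gauge_some_none {N : ℕ} (p : Bool × (Fin N → Bool)) (i : Fin N) :
    spin (gaugeEquiv N p (some i)) * spin (gaugeEquiv N p none) = spin (p.2 i) := by
  rw [spin_gauge_some, spin_gauge_none, mul_assoc, spin_mul_self, mul_one]

theorem bondSum_baseBonds_gauge {N k : ℕ} (im : Fin 2 → Fin k → Fin N)
    (p : Bool × (Fin N → Bool)) :
    bondSum (baseBonds im) (gaugeEquiv N p) = intSum im p.2 := by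
  rw [baseBonds, bondSum_sum_singleton, intSum]
  simp only [bondSpin_mk, spin_gauge_some_some, Fin.prod_univ_two]

theorem bondSum_starBonds_gauge {N k : ℕ} (im : Fin 1 → Fin k → Fin N)
    (p : Bool × (Fin N → Bool)) :
    bondSum (starBonds im) (gaugeEquiv N p) = cavSum im p.2 := by
  rw [starBonds, bondSum_sum_singleton, cavSum]
  simp only [bondSpin_mk, spin_gauge_some_none, Fin.prod_univ_one]

theorem sum_prod_mul_prod_div_pow {X : Type*} [Fintype X] (n : ℕ) (h w : X → ℝ) (Z : ℝ) :
    (∑ σs : Fin n → X, (∏ a, h (σs a)) * ∏ a, w (σs a)) / Z ^ n =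
      ((∑ σ, h σ * w σ) / Z) ^ n := by
  rw [div_pow, Fintype.sum_pow]
  simp only [Finset.prod_mul_distrib]

theorem OmegaPert_qOv {N k k' : ℕ} (β : ℝ) (im : Fin 2 → Fin k → Fin N)
    (im' : Fin 1 → Fin k' → Fin N) (n : ℕ) :
    OmegaPert β im im' n (fun σs => qOv N n σs ^ 1) =
      cavityObs N β n (baseBonds im + starBonds im') := by
  have h : ∀ x : Fin N, gibbs β (baseBonds im + starBonds im') (siteSpin {some x, none}) =
      (∑ σ : Fin N → Bool, spin (σ x) * wpert β im im' σ) / Zpert β im im' := by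
    intro x
    refine gibbs_eq_of_gauge β _ (u := fun σ => intSum im σ + cavSum im' σ)
      (f := fun σ => spin (σ x)) (fun p => ?_) fun p => ?_
    · rw [siteSpin_pair, spin_gauge_some_none]
    · rw [bondSum_add, bondSum_baseBonds_gauge, bondSum_starBonds_gauge]
  simp only [cavityObs_apply, h, ← sum_prod_mul_prod_div_pow]
  rw [OmegaPert, ← Finset.sum_div, ← mul_div_assoc, Finset.sum_comm]
  simp only [pow_one, qOv, Finset.mul_sum, Finset.sum_mul, mul_assoc]

theorem OmegaB_qOv_sq {N k : ℕ} (β : ℝ) (im : Fin 2 → Fin k → Fin N) (n : ℕ) :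
    OmegaB β im n (fun σs => qOv N n σs ^ 2) = pairObs N β n (baseBonds im) := by
  have h : ∀ x y : Fin N, gibbs β (baseBonds im) (siteSpin {some x, some y}) =
      (∑ σ : Fin N → Bool, spin (σ x) * spin (σ y) * Real.exp (β * intSum im σ)) /
        Zpart β im := by
    intro x y
    refine gibbs_eq_of_gauge β _ (u := intSum im)
      (f := fun σ => spin (σ x) * spin (σ y)) (fun p => ?_) fun p => ?_
    · rw [siteSpin_pair, spin_gauge_some_some]
    · rw [bondSum_baseBonds_gauge]
  have hq : ∀ σs : Fin n → Fin N → Bool, qOv N n σs ^ 2 = ((N : ℝ) ^ 2)⁻¹ *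
      ∑ x : Fin N, ∑ y : Fin N, ∏ a, (spin (σs a x) * spin (σs a y)) := by
    intro σs
    simp only [qOv, mul_pow, inv_pow, Finset.prod_mul_distrib]
    rw [sq (∑ x : Fin N, _), Finset.sum_mul_sum]
  simp only [pairObs_apply, h, ← sum_prod_mul_prod_div_pow]
  simp only [OmegaB, hq, ← Finset.sum_div, ← mul_div_assoc]
  congr 1
  simp only [mul_assoc, ← Finset.mul_sum, Finset.sum_mul]
  congr 1
  rw [Finset.sum_comm]
  exact Finset.sum_congr rfl fun x _ => Finset.sum_comm

theorem avgIdx_two_baseBonds {N : ℕ} (k : ℕ) (F : Obs (Sym2 (Option (Fin N)))) :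
    avgIdx N 2 k (fun im => F (baseBonds im)) = (avgBase N ^ k) F 0 := by
  rw [avgBase, avgElem_pow_apply, avgIdx, ← ((Equiv.piComm fun (_ : Fin 2) (_ : Fin k) =>
    Fin N).trans ((Equiv.refl (Fin k)).arrowCongr (finTwoArrowEquiv (Fin N)))).sum_comp]
  simp only [zero_add, Fintype.card_prod, Fintype.card_fin, Nat.cast_mul]
  rw [← sq, ← pow_mul]
  rfl

theorem avgIdx_one_starBonds {N : ℕ} (k : ℕ) (F : Obs (Sym2 (Option (Fin N))))
    (s : Multiset (Sym2 (Option (Fin N)))) :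
    avgIdx N 1 k (fun im => F (s + starBonds im)) = (avgStar N ^ k) F s := by
  rw [avgStar, avgElem_pow_apply, avgIdx, ← (Equiv.funUnique (Fin 1) (Fin k → Fin N)).sum_comp]
  simp only [Fintype.card_fin, one_mul]
  rfl

theorem qPowAvgPert_eq (N : ℕ) (γ β : ℝ) (n : ℕ) :
    qPowAvgPert N 2 γ β 1 n 1 = poissonExp (γ * N) (avgBase N)
      (poissonExp (2 * γ) (avgStar N) (cavityObs N β n)) 0 := by
  have h : ∀ (k : ℕ) (im : Fin 2 → Fin k → Fin N),
      ∑' k' : ℕ, pois (2 * γ * 1) k' * avgIdx N (2 - 1) k' (fun im' =>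
        OmegaPert β im im' n (fun σs => qOv N n σs ^ 1)) =
      poissonExp (2 * γ) (avgStar N) (cavityObs N β n) (baseBonds im) := by
    intro k im
    rw [← (hasSum_poissonExp _ _ _ _).tsum_eq, mul_one]
    refine tsum_congr fun k' => ?_
    rw [← avgIdx_one_starBonds]
    simp only [← OmegaPert_qOv]
  simp only [qPowAvgPert, EquenchCav, h, avgIdx_two_baseBonds]
  exact (hasSum_poissonExp _ _ _ _).tsum_eq

theorem qPowAvg_eq (N : ℕ) (γ β : ℝ) (n : ℕ) :
    qPowAvg N 2 γ β n 2 = poissonExp (γ * N) (avgBase N) (pairObs N β n) 0 := by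
  simp only [qPowAvg, Equench, OmegaB_qOv_sq, avgIdx_two_baseBonds]
  exact (hasSum_poissonExp _ _ _ _).tsum_eq

end Observables

section Comparison

theorem poissonExp_avgElem_le {E κ : Type*} [Fintype κ] [Nonempty κ] {lam : ℝ} (hlam : 0 ≤ lam)
    (c : κ → E) (F : Obs E) (s : Multiset E) {b : ℕ → ℝ} {B : ℝ}
    (h : ∀ t : Multiset E, F (s + t) ≤ b t.card) (hb : HasSum (fun k => pois lam k * b k) B) :
    poissonExp lam (avgElem c) F s ≤ B := by
  refine hasSum_le (fun k => mul_le_mul_of_nonneg_left ?_ (pois_nonneg hlam k))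
    (hasSum_poissonExp _ _ _ _) hb
  have hpos : (0 : ℝ) < (Fintype.card κ : ℝ) ^ k := by
    have : 0 < Fintype.card κ := Fintype.card_pos
    positivity
  rw [avgElem_pow_apply, inv_mul_le_iff₀ hpos]
  calc ∑ f : Fin k → κ, F (s + ∑ ν, {c (f ν)}) ≤ ∑ f : Fin k → κ, b k :=
        Finset.sum_le_sum fun f _ => by simpa using h (∑ ν, {c (f ν)})
    _ = _ := by simp

theorem le_poissonExp_avgElem {E κ : Type*} [Fintype κ] [Nonempty κ] {lam : ℝ} (hlam : 0 ≤ lam)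
    (c : κ → E) (F : Obs E) (s : Multiset E) (h : ∀ t, F s ≤ F (s + t)) :
    F s ≤ poissonExp lam (avgElem c) F s := by
  have h1 := poissonExp_avgElem_le hlam c (-F) s (b := fun _ => -F s)
    (fun t => neg_le_neg (h t)) ((hasSum_pois lam).mul_right _)
  rw [map_neg, one_mul] at h1
  exact neg_le_neg_iff.1 h1

/-- Poisson averages of a bounded observable vary little with the mean. -/
theorem abs_poissonExp_avgElem_sub_le {E κ : Type*} [Fintype κ] {lam mu η : ℝ} (hlam : 0 < lam)
    (hmu : 0 ≤ mu) (hη : 0 < η) (c : κ → E) {F : Obs E} (hF : ∀ s, |F s| ≤ 1) (s : Multiset E) :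
    |poissonExp mu (avgElem c) F s - poissonExp lam (avgElem c) F s| ≤
      η / 2 + (Real.exp ((mu - lam) ^ 2 / lam) - 1) / (2 * η) := by
  rw [← (hasSum_poissonExp mu _ _ _).tsum_eq, ← (hasSum_poissonExp lam _ _ _).tsum_eq]
  exact abs_tsum_pois_sub_le hlam hmu hη fun k => abs_avgElem_pow_le c k hF s

theorem pow_sub_pow_le_mul_sub {a b : ℝ} (hb : 0 ≤ b) (hab : b ≤ a) (ha : a ≤ 1) (n : ℕ) :
    a ^ n - b ^ n ≤ n * (a - b) := by
  induction n with
  | zero => simp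
  | succ n ih =>
    have h1 : a * (a ^ n - b ^ n) ≤ a ^ n - b ^ n :=
      mul_le_of_le_one_left (sub_nonneg.2 (pow_le_pow_left₀ hb hab n)) ha
    have h2 : b ^ n * (a - b) ≤ a - b :=
      mul_le_of_le_one_left (sub_nonneg.2 hab) (pow_le_one₀ hb (hab.trans ha))
    push_cast
    calc a ^ (n + 1) - b ^ (n + 1) = a * (a ^ n - b ^ n) + b ^ n * (a - b) := by ring
      _ ≤ (n + 1) * (a - b) := by linarith

variable {N : ℕ}

theorem inv_sq_mul_sum_sum_const (hN : N ≠ 0) (c : ℝ) :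
    ((N : ℝ) ^ 2)⁻¹ * ∑ _x : Fin N, ∑ _y : Fin N, c = c := by
  have : (N : ℝ) ≠ 0 := Nat.cast_ne_zero.2 hN
  simp only [Finset.sum_const, Finset.card_univ, Fintype.card_fin, nsmul_eq_mul]
  field_simp

theorem abs_pairObs_le (hN : N ≠ 0) (β : ℝ) (n : ℕ) (s : Multiset (Sym2 (Option (Fin N)))) :
    |pairObs N β n s| ≤ 1 := by
  rw [pairObs_apply, abs_mul, abs_of_nonneg (by positivity : (0 : ℝ) ≤ ((N : ℝ) ^ 2)⁻¹)]
  refine le_trans ?_ (inv_sq_mul_sum_sum_const hN 1).le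
  refine mul_le_mul_of_nonneg_left ?_ (by positivity)
  refine (Finset.abs_sum_le_sum_abs _ _).trans (Finset.sum_le_sum fun x _ => ?_)
  exact (Finset.abs_sum_le_sum_abs _ _).trans
    (Finset.sum_le_sum fun y _ => abs_corrPow_le β n (some x) (some y) s)

theorem pairObs_le_add {β : ℝ} (hβ : 0 ≤ β) (n : ℕ) (s t : Multiset (Sym2 (Option (Fin N)))) :
    pairObs N β n s ≤ pairObs N β n (s + t) := by
  rw [pairObs_apply, pairObs_apply]
  refine mul_le_mul_of_nonneg_left ?_ (by positivity)
  exact Finset.sum_le_sum fun x _ => Finset.sum_le_sum fun y _ =>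
    pow_le_pow_left₀ (gibbs_siteSpin_nonneg hβ s _) (gibbs_siteSpin_le_add hβ s t _) n

theorem pairObs_add_sub_le {β : ℝ} (hβ : 0 ≤ β) (n : ℕ)
    (s t : Multiset (Sym2 (Option (Fin N)))) :
    pairObs N β n (s + t) - pairObs N β n s ≤
      n * (gibbs β (s + t) (fun σ => mag N σ ^ 2) - gibbs β s (fun σ => mag N σ ^ 2)) := by
  rw [pairObs_apply, pairObs_apply, gibbs_mag_sq, gibbs_mag_sq, ← mul_sub, ← mul_sub,
    mul_left_comm]
  refine mul_le_mul_of_nonneg_left ?_ (by positivity)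
  simp only [← Finset.sum_sub_distrib, Finset.mul_sum]
  exact Finset.sum_le_sum fun x _ => Finset.sum_le_sum fun y _ =>
    pow_sub_pow_le_mul_sub (gibbs_siteSpin_nonneg hβ s _) (gibbs_siteSpin_le_add hβ s t _)
      (abs_le.1 (abs_gibbs_siteSpin_le β _ _)).2 n

/-- The mean squared magnetization. -/
noncomputable def magSqObs (N : ℕ) (β : ℝ) : Obs (Sym2 (Option (Fin N))) :=
  Obs.ofBounded (fun s => gibbs β s (fun σ => mag N σ ^ 2)) 1 fun s => abs_gibbs_le β s fun σ => by
    rw [abs_pow]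
    exact pow_le_one₀ (abs_nonneg _) (abs_mag_le N σ)

/-- The variance of the squared magnetization. -/
noncomputable def magVarObs (N : ℕ) (β : ℝ) : Obs (Sym2 (Option (Fin N))) :=
  Obs.ofBounded (magVar N β) 1 fun s => by
    rw [abs_of_nonneg (magVar_nonneg N β s)]
    exact magVar_le_one N β s

theorem magSqObs_apply (β : ℝ) (s : Multiset (Sym2 (Option (Fin N)))) :
    magSqObs N β s = gibbs β s (fun σ => mag N σ ^ 2) := rfl

theorem magVarObs_apply (β : ℝ) (s : Multiset (Sym2 (Option (Fin N)))) :
    magVarObs N β s = magVar N β s := rfl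

theorem abs_magSqObs_le (β : ℝ) (s : Multiset (Sym2 (Option (Fin N)))) : |magSqObs N β s| ≤ 1 :=
  abs_gibbs_le β s fun σ => by
    rw [abs_pow]
    exact pow_le_one₀ (abs_nonneg _) (abs_mag_le N σ)

theorem magSqObs_le_add {β : ℝ} (hβ : 0 ≤ β) (s t : Multiset (Sym2 (Option (Fin N)))) :
    magSqObs N β s ≤ magSqObs N β (s + t) := by
  rw [magSqObs_apply, magSqObs_apply, gibbs_mag_sq, gibbs_mag_sq]
  refine mul_le_mul_of_nonneg_left ?_ (by positivity)
  exact Finset.sum_le_sum fun x _ => Finset.sum_le_sum fun y _ => gibbs_siteSpin_le_add hβ s t _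

/-- Exchanging the cavity site with another site costs at most the contribution of the diagonal. -/
theorem abs_cavityObs_sub_pairObs_le (hN : N ≠ 0) {r : ℝ} (hr : 0 ≤ r) (β : ℝ) (n : ℕ) :
    |poissonExp (r * (N : ℝ) ^ 2) (avgBase N)
        (poissonExp (2 * r * (N : ℝ)) (avgStar N) (cavityObs N β n)) 0 -
      poissonExp (r * (N : ℝ) ^ 2) (avgBase N)
        (poissonExp (2 * r * (N : ℝ)) (avgStar N) (pairObs N β n)) 0| ≤ 2 / N := by
  have hN' : (N : ℝ) ≠ 0 := Nat.cast_ne_zero.2 hN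
  set L : Obs (Sym2 (Option (Fin N))) →L[ℝ] ℝ := (evalAt 0).comp
    ((poissonExp (r * (N : ℝ) ^ 2) (avgBase N)).comp
      (poissonExp (2 * r * (N : ℝ)) (avgStar N))) with hL
  have hLC : ∀ i j, |L (corrPow β n i j)| ≤ 1 := fun i j =>
    abs_poissonExp_avgElem_le (by positivity) _
      (fun s => abs_poissonExp_avgElem_le (by positivity) _ (abs_corrPow_le β n i j) s) 0
  change |L (cavityObs N β n) - L (pairObs N β n)| ≤ 2 / N
  have h1 : L (cavityObs N β n) = ((N : ℝ) ^ 2)⁻¹ *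
      ∑ x : Fin N, ∑ _y : Fin N, L (corrPow β n (some x) none) := by
    simp only [cavityObs, map_smul, map_sum, smul_eq_mul, Finset.sum_const, Finset.card_univ,
      Fintype.card_fin, nsmul_eq_mul, ← Finset.mul_sum]
    field_simp
  have h2 : L (pairObs N β n) = ((N : ℝ) ^ 2)⁻¹ *
      ∑ x : Fin N, ∑ y : Fin N, L (corrPow β n (some x) (some y)) := by
    simp only [pairObs, map_smul, map_sum, smul_eq_mul]
  have h3 : ∀ x y : Fin N, |L (corrPow β n (some x) none) - L (corrPow β n (some x) (some y))| ≤
      if x = y then 2 else 0 := by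
    intro x y
    split_ifs with hxy
    · refine (abs_sub _ _).trans ?_
      linarith [hLC (some x) none, hLC (some x) (some y)]
    · have h4 : L (corrPow β n (some x) none) = L (corrPow β n (some x) (some y)) :=
        poissonExp_corrPow_exchange hN r β n hxy
      rw [h4, sub_self, abs_zero]
  rw [h1, h2, ← mul_sub, abs_mul, abs_of_nonneg (by positivity : (0 : ℝ) ≤ ((N : ℝ) ^ 2)⁻¹)]
  simp only [← Finset.sum_sub_distrib]
  calc ((N : ℝ) ^ 2)⁻¹ * |∑ x : Fin N, ∑ y : Fin N,
        (L (corrPow β n (some x) none) - L (corrPow β n (some x) (some y)))|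
      ≤ ((N : ℝ) ^ 2)⁻¹ * ∑ x : Fin N, ∑ y : Fin N, if x = y then (2 : ℝ) else 0 :=
        mul_le_mul_of_nonneg_left ((Finset.abs_sum_le_sum_abs _ _).trans
          (Finset.sum_le_sum fun x _ => (Finset.abs_sum_le_sum_abs _ _).trans
            (Finset.sum_le_sum fun y _ => h3 x y))) (by positivity)
    _ = 2 / N := by
        simp only [Finset.sum_ite_eq, Finset.mem_univ, if_true, Finset.sum_const, Finset.card_univ,
          Fintype.card_fin, nsmul_eq_mul]
        field_simp

theorem poissonExp_avgStar_pairObs_sub_le (hN : N ≠ 0) {β lam ε : ℝ} (hβ : 0 ≤ β)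
    (hlam : 0 ≤ lam) (hε : 0 < ε) (n : ℕ) (s : Multiset (Sym2 (Option (Fin N)))) :
    poissonExp lam (avgStar N) (pairObs N β n) s ≤ pairObs N β n s +
      (n * (ε / 2) + n * Real.exp (lam * (Real.exp (2 * β) - 1)) / (2 * ε) * magVar N β s) := by
  have : Nonempty (Fin N) := ⟨⟨0, Nat.pos_of_ne_zero hN⟩⟩
  refine poissonExp_avgElem_le hlam _ _ s (b := fun k => (pairObs N β n s + n * (ε / 2)) +
    Real.exp (2 * β * k) * (n / (2 * ε) * magVar N β s)) (fun t => ?_) ?_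
  · have h1 := pairObs_add_sub_le hβ n s t
    have h2 := mul_le_mul_of_nonneg_left (gibbs_mag_sq_add_sub_le N hβ hε s t) (Nat.cast_nonneg n)
    have h3 : (n : ℝ) * (ε / 2 + Real.exp (2 * β * t.card) * magVar N β s / (2 * ε)) =
        n * (ε / 2) + Real.exp (2 * β * t.card) * (n / (2 * ε) * magVar N β s) := by ring
    linarith
  · have h1 := ((hasSum_pois lam).mul_right (pairObs N β n s + n * (ε / 2))).add
      ((hasSum_pois_mul_exp lam (2 * β)).mul_right (n / (2 * ε) * magVar N β s))
    rw [show pairObs N β n s + (n * (ε / 2) +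
        n * Real.exp (lam * (Real.exp (2 * β) - 1)) / (2 * ε) * magVar N β s) =
      1 * (pairObs N β n s + n * (ε / 2)) +
        Real.exp (lam * (Real.exp (2 * β) - 1)) * (n / (2 * ε) * magVar N β s) by ring]
    exact h1.congr_fun fun k => by ring

/-- The variance of the squared magnetization is small on average over the number of bonds. -/
theorem poissonExp_magVarObs_le (hN : N ≠ 0) {β lam δ : ℝ} (hβ : 0 ≤ β) (hlam : 0 ≤ lam)
    (hδ : 0 ≤ δ) :
    pois δ 1 * (Real.sinh β * Real.exp (-β)) * poissonExp lam (avgBase N) (magVarObs N β) 0 ≤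
      poissonExp (lam + δ) (avgBase N) (magSqObs N β) 0 -
        poissonExp lam (avgBase N) (magSqObs N β) 0 := by
  have : Nonempty (Fin N) := ⟨⟨0, Nat.pos_of_ne_zero hN⟩⟩
  have hpt : ∀ s, ((pois δ 1 * (Real.sinh β * Real.exp (-β))) • magVarObs N β) s ≤
      (poissonExp δ (avgBase N) (magSqObs N β) - magSqObs N β) s := by
    intro s
    refine le_trans ?_ (le_poissonExp_avgElem_sub hδ _ (magSqObs_le_add hβ) s)
    rw [Obs.smul_apply, mul_assoc]
    refine mul_le_mul_of_nonneg_left ((magVar_le N hβ s).trans_eq ?_) (pois_nonneg hδ 1)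
    rw [avgElem_apply, Fintype.sum_prod_type, Fintype.card_prod, Fintype.card_fin]
    simp only [Finset.sum_sub_distrib, mul_sub]
    rw [inv_sq_mul_sum_sum_const hN, Nat.cast_mul, ← sq]
    rfl
  have h := poissonExp_avgElem_mono hlam (fun ij : Fin N × Fin N => s(some ij.1, some ij.2)) hpt 0
  change poissonExp lam (avgBase N) _ 0 ≤ poissonExp lam (avgBase N) _ 0 at h
  rw [map_smul, map_sub, Obs.smul_apply, Obs.sub_apply] at h
  rwa [poissonExp_add]

end Comparison

section Rate

/-- A bound for the change of Poisson averages between the connectivities `Nα/(N+1)` and `α`. -/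
noncomputable def fillRate (α : ℝ) (N : ℕ) : ℝ := √(Real.exp (α / ((N : ℝ) + 1)) - 1)

theorem fillRate_pos {α : ℝ} (hα : 0 < α) (N : ℕ) : 0 < fillRate α N := by
  have h : 0 < α / ((N : ℝ) + 1) := by positivity
  exact Real.sqrt_pos.2 (sub_pos.2 (Real.one_lt_exp_iff.2 h))

theorem tendsto_fillRate (α : ℝ) : Tendsto (fillRate α) atTop (nhds 0) := by
  have h1 : Tendsto (fun N : ℕ => α / ((N : ℝ) + 1)) atTop (nhds 0) :=
    tendsto_const_nhds.div_atTop
      (tendsto_atTop_add_const_right _ _ tendsto_natCast_atTop_atTop)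
  have h2 : Continuous fun x : ℝ => √(Real.exp x - 1) := by fun_prop
  have h3 := (h2.tendsto 0).comp h1
  rwa [Real.exp_zero, sub_self, Real.sqrt_zero] at h3

theorem abs_poissonExp_avgBase_sub_le {N : ℕ} (hN : N ≠ 0) {α : ℝ} (hα : 0 < α)
    {F : Obs (Sym2 (Option (Fin N)))} (hF : ∀ s, |F s| ≤ 1) :
    |poissonExp (α * N) (avgBase N) F 0 -
      poissonExp (α / ((N : ℝ) + 1) * (N : ℝ) ^ 2) (avgBase N) F 0| ≤ fillRate α N := by
  have hN' : (0 : ℝ) < N := Nat.cast_pos.2 (Nat.pos_of_ne_zero hN)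
  have ht := fillRate_pos hα N
  refine (abs_poissonExp_avgElem_sub_le (by positivity) (by positivity) ht _ hF 0).trans_eq ?_
  have h1 : (α * N - α / ((N : ℝ) + 1) * (N : ℝ) ^ 2) ^ 2 / (α / ((N : ℝ) + 1) * (N : ℝ) ^ 2) =
      α / ((N : ℝ) + 1) := by
    field_simp
    ring
  have h2 : Real.exp (α / ((N : ℝ) + 1)) - 1 = fillRate α N ^ 2 := by
    rw [fillRate, Real.sq_sqrt]
    exact sub_nonneg.2 (Real.one_le_exp (by positivity))
  rw [h1, h2]
  field_simp
  ring

theorem poissonExp_magVarObs_le_fillRate {N : ℕ} (hN : N ≠ 0) {α β : ℝ} (hα : 0 < α)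
    (hβ : 0 < β) :
    poissonExp (α / ((N : ℝ) + 1) * (N : ℝ) ^ 2) (avgBase N) (magVarObs N β) 0 ≤
      (Real.exp (-α) * (α / 2) * (Real.sinh β * Real.exp (-β)))⁻¹ * fillRate α N := by
  have hN1 : (1 : ℝ) ≤ N := Nat.one_le_cast.2 (Nat.pos_of_ne_zero hN)
  have hs : 0 < Real.sinh β := Real.sinh_pos_iff.2 hβ
  set δ := α * N / ((N : ℝ) + 1) with hδ
  have hδ0 : 0 ≤ δ := by positivity
  have hδ1 : δ ≤ α := by
    rw [hδ, div_le_iff₀ (by positivity)]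
    nlinarith
  have hδ2 : α / 2 ≤ δ := by
    rw [hδ, div_le_div_iff₀ (by positivity) (by positivity)]
    nlinarith
  have hadd : α / ((N : ℝ) + 1) * (N : ℝ) ^ 2 + δ = α * N := by
    rw [hδ]
    field_simp
  have h := poissonExp_magVarObs_le hN hβ.le
    (show 0 ≤ α / ((N : ℝ) + 1) * (N : ℝ) ^ 2 by positivity) hδ0
  rw [hadd] at h
  have h2 := (le_abs_self _).trans (abs_poissonExp_avgBase_sub_le hN hα (abs_magSqObs_le β))
  have hV : 0 ≤ poissonExp (α / ((N : ℝ) + 1) * (N : ℝ) ^ 2) (avgBase N) (magVarObs N β) 0 := by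
    have := poissonExp_avgElem_mono (show 0 ≤ α / ((N : ℝ) + 1) * (N : ℝ) ^ 2 by positivity)
      (fun ij : Fin N × Fin N => s(some ij.1, some ij.2)) (F := 0) (G := magVarObs N β)
      (fun s => magVar_nonneg N β s) 0
    rw [(poissonExp _ _).map_zero] at this
    exact this
  have hp : Real.exp (-α) * (α / 2) ≤ pois δ 1 := by
    simp only [pois, pow_one, Nat.factorial_one, Nat.cast_one, div_one]
    exact mul_le_mul (Real.exp_le_exp.2 (neg_le_neg hδ1)) hδ2 (by positivity) (by positivity)
  rw [← div_eq_inv_mul, le_div_iff₀' (by positivity)]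
  refine le_trans ?_ (h.trans h2)
  exact mul_le_mul_of_nonneg_right (mul_le_mul_of_nonneg_right hp (by positivity)) hV

theorem abs_poissonExp_avgStar_pairObs_sub_le {N : ℕ} (hN : N ≠ 0) {α β : ℝ} (hα : 0 < α)
    (hβ : 0 < β) (n : ℕ) :
    |poissonExp (α / ((N : ℝ) + 1) * (N : ℝ) ^ 2) (avgBase N)
        (poissonExp (2 * (α / ((N : ℝ) + 1)) * (N : ℝ)) (avgStar N) (pairObs N β n)) 0 -
      poissonExp (α / ((N : ℝ) + 1) * (N : ℝ) ^ 2) (avgBase N) (pairObs N β n) 0| ≤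
      n / 2 * (1 + Real.exp (2 * α * (Real.exp (2 * β) - 1)) *
        (Real.exp (-α) * (α / 2) * (Real.sinh β * Real.exp (-β)))⁻¹) * √(fillRate α N) := by
  have : Nonempty (Fin N) := ⟨⟨0, Nat.pos_of_ne_zero hN⟩⟩
  have hlam : 0 ≤ 2 * (α / ((N : ℝ) + 1)) * (N : ℝ) := by positivity
  have hlam2 : 2 * (α / ((N : ℝ) + 1)) * (N : ℝ) ≤ 2 * α := by
    rw [mul_assoc, div_mul_eq_mul_div]
    refine mul_le_mul_of_nonneg_left ?_ zero_le_two
    rw [div_le_iff₀ (by positivity)]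
    nlinarith
  have hLam : 0 ≤ α / ((N : ℝ) + 1) * (N : ℝ) ^ 2 := by positivity
  have hV := poissonExp_magVarObs_le_fillRate hN hα hβ
  set lam := 2 * (α / ((N : ℝ) + 1)) * (N : ℝ)
  set Lam := α / ((N : ℝ) + 1) * (N : ℝ) ^ 2
  set D := (Real.exp (-α) * (α / 2) * (Real.sinh β * Real.exp (-β)))⁻¹
  set C := Real.exp (2 * α * (Real.exp (2 * β) - 1)) with hC
  set ε := √(fillRate α N) with hε
  have hε0 : 0 < ε := Real.sqrt_pos.2 (fillRate_pos hα N)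
  have hε2 : fillRate α N = ε ^ 2 := (Real.sq_sqrt (fillRate_pos hα N).le).symm
  have hC2 : Real.exp (lam * (Real.exp (2 * β) - 1)) ≤ C :=
    Real.exp_le_exp.2 (mul_le_mul_of_nonneg_right hlam2
      (sub_nonneg.2 (Real.one_le_exp (by positivity))))
  have hlow : poissonExp Lam (avgBase N) (pairObs N β n) 0 ≤
      poissonExp Lam (avgBase N) (poissonExp lam (avgStar N) (pairObs N β n)) 0 :=
    poissonExp_avgElem_mono hLam _
      (fun s => le_poissonExp_avgElem hlam _ _ s (pairObs_le_add hβ.le n s)) 0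
  have hup : poissonExp Lam (avgBase N)
      (poissonExp lam (avgStar N) (pairObs N β n) - pairObs N β n -
        (n * C / (2 * ε)) • magVarObs N β) 0 ≤ n * (ε / 2) := by
    refine poissonExp_avgElem_le hLam _ _ 0 (b := fun _ => n * (ε / 2)) (fun s => ?_)
      (by simpa only [one_mul] using (hasSum_pois Lam).mul_right (n * (ε / 2)))
    rw [zero_add, Obs.sub_apply, Obs.sub_apply, Obs.smul_apply, magVarObs_apply]
    have h1 := poissonExp_avgStar_pairObs_sub_le hN hβ.le hlam hε0 n s
    have h2 : n * Real.exp (lam * (Real.exp (2 * β) - 1)) / (2 * ε) * magVar N β s ≤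
        n * C / (2 * ε) * magVar N β s :=
      mul_le_mul_of_nonneg_right (div_le_div_of_nonneg_right
        (mul_le_mul_of_nonneg_left hC2 (Nat.cast_nonneg n)) (by positivity)) (magVar_nonneg N β s)
    linarith
  rw [abs_of_nonneg (sub_nonneg.2 hlow)]
  rw [map_sub, map_sub, map_smul, Obs.sub_apply, Obs.sub_apply, Obs.smul_apply] at hup
  have h1 := mul_le_mul_of_nonneg_left hV (show 0 ≤ n * C / (2 * ε) by positivity)
  have h2 : n * C / (2 * ε) * (D * fillRate α N) = n / 2 * (C * D) * ε := by
    rw [hε2]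
    field_simp
  linarith

theorem abs_qPowAvgPert_sub_qPowAvg_le {N : ℕ} (hN : N ≠ 0) {α β : ℝ} (hα : 0 < α) (hβ : 0 < β)
    (n : ℕ) :
    |qPowAvgPert N 2 ((N : ℝ) * α / ((N : ℝ) + 1)) β 1 n 1 - qPowAvg N 2 α β n 2| ≤
      2 / N + n / 2 * (1 + Real.exp (2 * α * (Real.exp (2 * β) - 1)) *
        (Real.exp (-α) * (α / 2) * (Real.sinh β * Real.exp (-β)))⁻¹) * √(fillRate α N) +
          fillRate α N := by
  have e1 : (N : ℝ) * α / ((N : ℝ) + 1) * N = α / ((N : ℝ) + 1) * (N : ℝ) ^ 2 := by ring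
  have e2 : 2 * ((N : ℝ) * α / ((N : ℝ) + 1)) = 2 * (α / ((N : ℝ) + 1)) * N := by ring
  have h1 := abs_cavityObs_sub_pairObs_le hN (show 0 ≤ α / ((N : ℝ) + 1) by positivity) β n
  have h2 := abs_poissonExp_avgStar_pairObs_sub_le hN hα hβ n
  have h3 := abs_poissonExp_avgBase_sub_le hN hα (abs_pairObs_le hN β n)
  rw [abs_sub_comm] at h3
  rw [qPowAvgPert_eq, qPowAvg_eq, e1, e2]
  exact (abs_sub_le _ _ _).trans
    (add_le_add ((abs_sub_le _ _ _).trans (add_le_add h1 h2)) h3)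

end Rate

/-- Filling of the multi-overlaps in the diluted Curie–Weiss model (`p = 2`, `γ = α`): for
every `n ≥ 1`, with `α̃_N = Nα/(N+1)`, the `t = 1` perturbed total average of `q_{1…n}`
converges to the unperturbed total average of the filled monomial `q_{1…n}²`:
`⟨q_{1…n}⟩_{N,t=1} - ⟨q_{1…n}²⟩_N → 0`. -/
theorem overlap_filling (α β : ℝ) (hα : 0 < α) (hβ : 0 < β) (n : ℕ) (hn : 1 ≤ n) :
    Tendsto (fun N : ℕ =>
        qPowAvgPert N 2 ((N : ℝ) * α / ((N : ℝ) + 1)) β 1 n 1 - qPowAvg N 2 α β n 2)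
      atTop (nhds 0) := by
  refine squeeze_zero_norm' (Eventually.mono (eventually_ne_atTop 0) fun N hN =>
    (Real.norm_eq_abs _).trans_le (abs_qPowAvgPert_sub_qPowAvg_le hN hα hβ n)) ?_
  have h1 : Tendsto (fun N : ℕ => (2 : ℝ) / N) atTop (nhds 0) :=
    tendsto_const_nhds.div_atTop tendsto_natCast_atTop_atTop
  have h2 := tendsto_fillRate α
  have h3 := ((Real.continuous_sqrt.tendsto 0).comp h2).const_mul
    (n / 2 * (1 + Real.exp (2 * α * (Real.exp (2 * β) - 1)) *
      (Real.exp (-α) * (α / 2) * (Real.sinh β * Real.exp (-β)))⁻¹))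
  rw [Real.sqrt_zero, mul_zero] at h3
  simpa using (h1.add h3).add h2
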